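/- For every positive integer k there are, up to isomorphism, only finitely many finite solvable groups having exactly k irreducible characters that are Q_pp-valued; equivalently, there exists a bound B(k) such that every finite solvable group G with exactly k Q_pp-valued irreducible characters satisfies |G| ≤ B(k). -/

import Mathlib

open scoped Classical

noncomputable section

/-- `Qfield p` is the subfield of `ℂ` obtained by adjoining to `ℚ` all `p^a`-th
roots of unity for all positive integers `a` (any subfield of `ℂ` contains `ℚ`). -/
def Qfield (p : ℕ) : Subfield ℂ :=
  Subfield.closure {x : ℂ | ∃ a : ℕ, 0 < a ∧ x ^ p ^ a = 1}

/-- `χ : G → ℂ` is an irreducible (ordinary, complex) character of `G` if it is the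
character of some simple finite-dimensional complex representation of `G`. -/
def IsIrreducibleCharacter (G : Type) [Group G] (χ : G → ℂ) : Prop :=
  ∃ V : FDRep ℂ G, CategoryTheory.Simple V ∧ χ = fun g => V.character g

/-- The set of `Q_pp`-valued irreducible characters of `G`: irreducible characters all
of whose values lie in `Qfield p` for some prime `p`. -/
def QppValuedIrrChars (G : Type) [Group G] : Set (G → ℂ) :=
  {χ | IsIrreducibleCharacter G χ ∧ ∃ p : ℕ, p.Prime ∧ ∀ g, χ g ∈ Qfield p}

/-- `χ` is the trace of a complex matrix representation of `G`. -/
def IsMatrixCharacter (G : Type) [Group G] (χ : G → ℂ) : Prop :=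
  ∃ (n : ℕ) (ρ : G →* Matrix (Fin n) (Fin n) ℂ), ∀ g, χ g = (ρ g).trace

/-- The bilinear form `|G|⁻¹ ∑ a(g) b(g⁻¹)` on functions on `G`. -/
def charForm {G : Type} [Group G] [Fintype G] (a b : G → ℂ) : ℂ :=
  (Nat.card G : ℂ)⁻¹ * ∑ g, a g * b g⁻¹

section Plain

variable {G : Type} [Group G]

theorem isMatrixCharacter_of_representation {V : Type} [AddCommGroup V] [Module ℂ V]
    [FiniteDimensional ℂ V] (ρ : G →* (V →ₗ[ℂ] V)) :
    IsMatrixCharacter G (fun g => LinearMap.trace ℂ V (ρ g)) := by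
  let b := Module.finBasis ℂ V
  refine ⟨Module.finrank ℂ V,
    ((LinearMap.toMatrixAlgEquiv b : (V →ₗ[ℂ] V) →* Matrix _ _ ℂ)).comp ρ, fun g => ?_⟩
  simp only [MonoidHom.comp_apply]
  exact LinearMap.trace_eq_matrix_trace ℂ b (ρ g)

theorem IsMatrixCharacter.exists_fdRep {χ : G → ℂ} (h : IsMatrixCharacter G χ) :
    ∃ V : FDRep ℂ G, χ = V.character := by
  obtain ⟨n, ρ, hρ⟩ := h
  let τ : Representation ℂ G (Fin n → ℂ) :=
    (Matrix.toLinAlgEquiv' : Matrix (Fin n) (Fin n) ℂ ≃ₐ[ℂ] _).toAlgHom.toMonoidHom'.comp ρ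
  refine ⟨FDRep.of τ, funext fun g => ?_⟩
  rw [hρ]
  exact (Matrix.trace_toLin'_eq (ρ g)).symm

theorem FDRep.isMatrixCharacter (V : FDRep ℂ G) : IsMatrixCharacter G V.character :=
  isMatrixCharacter_of_representation (V := V) V.ρ

theorem IsIrreducibleCharacter.isMatrixCharacter {χ : G → ℂ} (h : IsIrreducibleCharacter G χ) :
    IsMatrixCharacter G χ := by
  obtain ⟨V, -, rfl⟩ := h
  exact V.isMatrixCharacter

theorem IsMatrixCharacter.map_conj {χ : G → ℂ} (h : IsMatrixCharacter G χ) (g x : G) :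
    χ (x * g * x⁻¹) = χ g := by
  obtain ⟨V, rfl⟩ := h.exists_fdRep
  exact V.char_conj g x

variable [Fintype G]

theorem charForm_comm (a b : G → ℂ) : charForm a b = charForm b a := by
  unfold charForm
  congr 1
  refine Fintype.sum_equiv (Equiv.inv G) _ _ fun g => ?_
  simp [mul_comm]

instance invertibleCard : Invertible (Nat.card G : ℂ) :=
  invertibleOfNonzero (Nat.cast_ne_zero.mpr Nat.card_pos.ne')

theorem isIrreducibleCharacter_iff {χ : G → ℂ} :
    IsIrreducibleCharacter G χ ↔ IsMatrixCharacter G χ ∧ charForm χ χ = 1 := by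
  have hc : (Nat.card G : ℂ) ≠ 0 := Nat.cast_ne_zero.mpr Nat.card_pos.ne'
  constructor
  · intro h
    refine ⟨h.isMatrixCharacter, ?_⟩
    obtain ⟨V, hV, rfl⟩ := h
    have := (FDRep.simple_iff_char_is_norm_one V).1 hV
    unfold charForm
    rw [this, inv_mul_cancel₀ hc]
  · rintro ⟨h, h1⟩
    obtain ⟨V, rfl⟩ := h.exists_fdRep
    refine ⟨V, (FDRep.simple_iff_char_is_norm_one V).2 ?_, rfl⟩
    unfold charForm at h1
    field_simp at h1
    exact h1

theorem IsMatrixCharacter.charForm_natCast {χ η : G → ℂ} (hχ : IsMatrixCharacter G χ)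
    (hη : IsMatrixCharacter G η) : ∃ n : ℕ, charForm χ η = n := by
  obtain ⟨V, rfl⟩ := hχ.exists_fdRep
  obtain ⟨W, rfl⟩ := hη.exists_fdRep
  exact ⟨_, FDRep.scalar_product_char_eq_finrank_equivariant W V⟩

theorem IsIrreducibleCharacter.charForm_eq_zero {χ η : G → ℂ} (hχ : IsIrreducibleCharacter G χ)
    (hη : IsIrreducibleCharacter G η) (hne : χ ≠ η) : charForm χ η = 0 := by
  obtain ⟨V, hV, rfl⟩ := hχ
  obtain ⟨W, hW, rfl⟩ := hη
  have := FDRep.char_orthonormal V W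
  unfold charForm
  rw [this, if_neg]
  rintro ⟨i⟩
  exact hne (FDRep.char_iso i)

/-- The central element of the group algebra attached to a class function. -/
def classSum (f : G → ℂ) : MonoidAlgebra ℂ G := ∑ g : G, MonoidAlgebra.single g (f g⁻¹)

theorem classSum_comm {f : G → ℂ} (hf : ∀ x g, f (x * g * x⁻¹) = f g) (a : MonoidAlgebra ℂ G) :
    a * classSum f = classSum f * a := by
  induction a using MonoidAlgebra.induction_on with
  | of x =>
    simp only [MonoidAlgebra.of_apply, classSum, Finset.mul_sum, Finset.sum_mul,
      MonoidAlgebra.single_mul_single, one_mul, mul_one]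
    refine Fintype.sum_equiv (MulAut.conj x).toEquiv _ _ fun g => ?_
    have : f (x * g * x⁻¹)⁻¹ = f g⁻¹ := by
      rw [← hf x g⁻¹]; congr 1; group
    simp only [MulEquiv.toEquiv_eq_coe, MulEquiv.coe_toEquiv, MulAut.conj_apply, this]
    simp
  | add a b ha hb => rw [add_mul, mul_add, ha, hb]
  | smul r a ha => rw [smul_mul_assoc, mul_smul_comm, ha]

omit [Fintype G] in
theorem isSimpleModule_ofModule' (N : Type) [AddCommGroup N] [Module ℂ N]
    [Module (MonoidAlgebra ℂ G) N] [IsScalarTower ℂ (MonoidAlgebra ℂ G) N]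
    [IsSimpleModule (MonoidAlgebra ℂ G) N] :
    IsSimpleModule (MonoidAlgebra ℂ G)
      (Representation.ofModule' (k := ℂ) (G := G) N).asModule := by
  let e : (Representation.ofModule' (k := ℂ) (G := G) N).asModule ≃ₗ[MonoidAlgebra ℂ G] N :=
    { (Representation.ofModule' (k := ℂ) (G := G) N).asModuleEquiv with
      map_smul' := fun a x => by
        simp only [AddHom.toFun_eq_coe, LinearMap.coe_toAddHom, LinearEquiv.coe_coe,
          Representation.asModuleEquiv_map_smul, RingHom.id_apply]
        simp [Representation.asAlgebraHom, Representation.ofModule'] }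
  exact IsSimpleModule.congr e

/-- A class function orthogonal to all irreducible characters kills simple modules. -/
theorem classSum_smul_eq_zero {f : G → ℂ} (hf : ∀ x g, f (x * g * x⁻¹) = f g)
    (h : ∀ χ, IsIrreducibleCharacter G χ → charForm f χ = 0) (N : Type) [AddCommGroup N]
    [Module ℂ N] [Module (MonoidAlgebra ℂ G) N] [IsScalarTower ℂ (MonoidAlgebra ℂ G) N]
    [IsSimpleModule (MonoidAlgebra ℂ G) N] (m : N) : classSum f • m = 0 := by
  have hc : (Nat.card G : ℂ) ≠ 0 := Nat.cast_ne_zero.mpr Nat.card_pos.ne'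
  have hfin : FiniteDimensional ℂ N := Module.Finite.trans (R := ℂ) (MonoidAlgebra ℂ G) N
  let ρ : Representation ℂ G N := Representation.ofModule' N
  have : ρ.IsIrreducible := by
    rw [Representation.irreducible_iff_isSimpleModule_asModule]
    exact isSimpleModule_ofModule' N
  let V := FDRep.of ρ
  have hV : CategoryTheory.Simple V := by
    rw [FDRep.simple_iff_char_is_norm_one]
    have := Representation.char_orthonormal ρ ρ
    rw [if_pos ⟨Representation.Equiv.refl ρ⟩, inv_mul_eq_one₀ hc] at this
    exact this.symm
  have h0 := h _ ⟨V, hV, rfl⟩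
  let ψ : Module.End (MonoidAlgebra ℂ G) N :=
    { toFun := fun s => classSum f • s
      map_add' := fun a b => smul_add _ a b
      map_smul' := fun a b => by
        simp only [← mul_smul, RingHom.id_apply, classSum_comm hf] }
  obtain ⟨c, hcψ⟩ := (IsSimpleModule.algebraMap_end_bijective_of_isAlgClosed ℂ
    (A := MonoidAlgebra ℂ G) (V := N)).2 ψ
  have hact : ∀ s : N, c • s = classSum f • s := fun s => by
    have := LinearMap.congr_fun hcψ s
    simpa [ψ] using this
  have hsum : ∑ g : G, f g⁻¹ • ρ g = c • (LinearMap.id : N →ₗ[ℂ] N) := by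
    ext s
    rw [LinearMap.smul_apply, LinearMap.id_apply, hact, classSum, Finset.sum_smul,
      LinearMap.sum_apply]
    refine Finset.sum_congr rfl fun g _ => ?_
    have : (MonoidAlgebra.single g (f g⁻¹) : MonoidAlgebra ℂ G)
        = f g⁻¹ • MonoidAlgebra.single g 1 := by simp
    rw [this, smul_assoc]
    rfl
  have htr := congrArg (LinearMap.trace ℂ N) hsum
  rw [map_sum, map_smul, LinearMap.trace_id] at htr
  have hz : ∑ g : G, LinearMap.trace ℂ N (f g⁻¹ • ρ g) = 0 := by
    rw [charForm_comm] at h0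
    unfold charForm at h0
    rw [mul_eq_zero, or_iff_right (inv_ne_zero hc)] at h0
    rw [← h0]
    refine Finset.sum_congr rfl fun g _ => ?_
    rw [map_smul, smul_eq_mul, mul_comm]
    rfl
  rw [hz, smul_eq_mul, eq_comm, mul_eq_zero] at htr
  have : Nontrivial N := IsSimpleModule.nontrivial (MonoidAlgebra ℂ G) N
  have hc0 := htr.resolve_right (by exact_mod_cast Module.finrank_pos.ne')
  have := hact m
  rw [hc0, zero_smul] at this
  exact this.symm

theorem eq_zero_of_charForm_eq_zero {f : G → ℂ} (hf : ∀ x g, f (x * g * x⁻¹) = f g)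
    (h : ∀ χ, IsIrreducibleCharacter G χ → charForm f χ = 0) : f = 0 := by
  let φ : MonoidAlgebra ℂ G →ₗ[MonoidAlgebra ℂ G] MonoidAlgebra ℂ G :=
    { toFun := fun a => classSum f * a
      map_add' := mul_add _
      map_smul' := fun a b => by
        simp only [smul_eq_mul, RingHom.id_apply, ← mul_assoc, classSum_comm hf] }
  have htop : (⊤ : Submodule (MonoidAlgebra ℂ G) (MonoidAlgebra ℂ G)) ≤ LinearMap.ker φ := by
    rw [← IsSemisimpleModule.sSup_simples_eq_top]
    refine sSup_le fun S (hS : IsSimpleModule _ S) s hs => ?_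
    exact congrArg Subtype.val (classSum_smul_eq_zero hf h S ⟨s, hs⟩)
  have hz : classSum f = 0 := by
    have := htop (show (1 : MonoidAlgebra ℂ G) ∈ ⊤ from trivial)
    simpa [φ] using this
  funext g
  have := congrArg (fun a : MonoidAlgebra ℂ G => a.coeff g⁻¹) hz
  simpa [classSum, Finset.sum_apply', Finsupp.single_apply] using this

end Plain

section Expansion

variable {G : Type} [Group G] [Fintype G]

theorem charForm_add_left (a b c : G → ℂ) : charForm (a + b) c = charForm a c + charForm b c := by
  simp [charForm, add_mul, Finset.sum_add_distrib, mul_add]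

theorem charForm_smul_left (t : ℂ) (a c : G → ℂ) : charForm (t • a) c = t * charForm a c := by
  simp only [charForm, Pi.smul_apply, smul_eq_mul, mul_assoc, ← Finset.mul_sum]
  ring

theorem charForm_sum_left {ι : Type*} (s : Finset ι) (a : ι → G → ℂ) (c : G → ℂ) :
    charForm (∑ i ∈ s, a i) c = ∑ i ∈ s, charForm (a i) c := by
  induction s using Finset.induction_on with
  | empty => simp [charForm]
  | insert i s hi ih => rw [Finset.sum_insert hi, Finset.sum_insert hi, charForm_add_left, ih]

theorem charForm_sub_left (a b c : G → ℂ) : charForm (a - b) c = charForm a c - charForm b c := by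
  simp [charForm, sub_mul, Finset.sum_sub_distrib, mul_sub]

theorem IsIrreducibleCharacter.charForm_self {χ : G → ℂ} (h : IsIrreducibleCharacter G χ) :
    charForm χ χ = 1 := (isIrreducibleCharacter_iff.1 h).2

theorem IsIrreducibleCharacter.charForm_eq_ite {χ η : G → ℂ} (hχ : IsIrreducibleCharacter G χ)
    (hη : IsIrreducibleCharacter G η) : charForm χ η = if χ = η then 1 else 0 := by
  split_ifs with h
  · rw [← h, hχ.charForm_self]
  · exact hχ.charForm_eq_zero hη h

theorem setOf_isIrreducibleCharacter_finite : {χ : G → ℂ | IsIrreducibleCharacter G χ}.Finite := by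
  have : LinearIndependent ℂ (fun χ : {χ : G → ℂ | IsIrreducibleCharacter G χ} => (χ : G → ℂ)) := by
    rw [linearIndependent_iff']
    intro s c hc i hi
    have h := congrArg (fun f => charForm f (i : G → ℂ)) hc
    simp only [charForm_sum_left, charForm_smul_left] at h
    rw [Finset.sum_eq_single i] at h
    · rw [i.2.charForm_self, mul_one] at h
      simpa [charForm] using h
    · intro j _ hj
      rw [IsIrreducibleCharacter.charForm_eq_zero j.2 i.2 (fun e => hj (Subtype.ext e)), mul_zero]
    · exact fun h => absurd hi h
  exact this.setFinite

variable (G) in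
/-- The finite set of irreducible characters. -/
def irrChars : Finset (G → ℂ) := setOf_isIrreducibleCharacter_finite.toFinset

@[simp]
theorem mem_irrChars {χ : G → ℂ} : χ ∈ irrChars G ↔ IsIrreducibleCharacter G χ := by
  simp [irrChars]

theorem eq_sum_charForm_smul {f : G → ℂ} (hf : ∀ x g, f (x * g * x⁻¹) = f g) :
    f = ∑ χ ∈ irrChars G, charForm f χ • χ := by
  rw [← sub_eq_zero]
  apply eq_zero_of_charForm_eq_zero
  · intro x g
    simp only [Pi.sub_apply, hf, Finset.sum_apply, Pi.smul_apply]
    congr 1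
    refine Finset.sum_congr rfl fun χ hχ => ?_
    rw [(mem_irrChars.1 hχ).isMatrixCharacter.map_conj]
  · intro χ hχ
    rw [charForm_sub_left, charForm_sum_left, Finset.sum_eq_single χ]
    · rw [charForm_smul_left, hχ.charForm_self, mul_one, sub_self]
    · intro η hη hne
      rw [charForm_smul_left, (mem_irrChars.1 hη).charForm_eq_zero hχ hne, mul_zero]
    · exact fun h => absurd (mem_irrChars.2 hχ) h

end Expansion

section Diagonalization

theorem Matrix.exists_diagonal_of_pow_eq_one {n m : ℕ} (hm : 0 < m) (A : Matrix (Fin n) (Fin n) ℂ)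
    (hA : A ^ m = 1) : ∃ d : Fin n → ℂ, (∀ i, d i ^ m = 1) ∧
      (∀ P : Polynomial ℂ, (Polynomial.aeval A P).trace = ∑ i, P.eval (d i)) ∧
      A.det = ∏ i, d i := by
  let f : Module.End ℂ (Fin n → ℂ) := Matrix.toLinAlgEquiv' A
  have hf : f ^ m = 1 := by rw [← map_pow, hA, map_one]
  have hss : f.IsSemisimple := by
    refine Module.End.isSemisimple_of_squarefree_aeval_eq_zero
      (p := Polynomial.X ^ m - 1) ?_ (by simp [hf])
    exact (Polynomial.separable_X_pow_sub_C (1 : ℂ) (by exact_mod_cast hm.ne') one_ne_zero).squarefree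
  have htop := hss.iSup_eigenspace_eq_top
  let s : Set (Fin n → ℂ) := ⋃ μ, (f.eigenspace μ : Set (Fin n → ℂ))
  have hs : ⊤ ≤ Submodule.span ℂ s := by
    rw [← htop]
    exact iSup_le fun μ x hx => Submodule.subset_span (Set.mem_iUnion.2 ⟨μ, hx⟩)
  let b0 := Module.Basis.ofSpan hs
  have hb0 : ∀ i, b0 i ∈ s := fun i => Module.Basis.ofSpan_subset hs ⟨i, rfl⟩
  let b : Module.Basis (Fin n) ℂ (Fin n → ℂ) :=
    b0.reindex (b0.indexEquiv (Pi.basisFun ℂ (Fin n)))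
  have hb : ∀ i, ∃ μ, f (b i) = μ • b i := fun i => by
    obtain ⟨μ, hμ⟩ := Set.mem_iUnion.1 (hb0 ((b0.indexEquiv (Pi.basisFun ℂ (Fin n))).symm i))
    exact ⟨μ, by simpa [b] using Module.End.mem_eigenspace_iff.1 hμ⟩
  choose d hd using hb
  have hmat : LinearMap.toMatrixAlgEquiv b f = Matrix.diagonal d := by
    ext i j
    rw [LinearMap.toMatrixAlgEquiv_apply, hd, map_smul, Finsupp.smul_apply, Matrix.diagonal_apply,
      b.repr_self, Finsupp.single_apply]
    by_cases h : i = j <;> simp [h, eq_comm]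
  have hpoly : ∀ P : Polynomial ℂ, LinearMap.toMatrixAlgEquiv b (Polynomial.aeval f P) =
      Matrix.diagonal fun i => P.eval (d i) := fun P => by
    have := (Polynomial.aeval_algHom_apply (LinearMap.toMatrixAlgEquiv b).toAlgHom f P)
    rw [show (LinearMap.toMatrixAlgEquiv b) ((Polynomial.aeval f) P) =
      (LinearMap.toMatrixAlgEquiv b).toAlgHom ((Polynomial.aeval f) P) from rfl, ← this]
    rw [show (LinearMap.toMatrixAlgEquiv b).toAlgHom f = Matrix.diagonalAlgHom ℂ d from hmat,
      Polynomial.aeval_algHom_apply]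
    simp only [Matrix.diagonalAlgHom_apply]
    congr 1
    ext i
    rw [show ((Polynomial.aeval d) P) i = (Pi.evalAlgHom ℂ (fun _ => ℂ) i) ((Polynomial.aeval d) P)
      from rfl, ← Polynomial.aeval_algHom_apply]
    simp [Polynomial.aeval_def, Polynomial.eval₂_eq_eval_map]
  refine ⟨d, fun i => ?_, fun P => ?_, ?_⟩
  · have h := hpoly (Polynomial.X ^ m)
    rw [map_pow, Polynomial.aeval_X, hf, map_one] at h
    have := congrFun (congrFun h i) i
    simpa using this.symm
  · have h1 : Polynomial.aeval f P = Matrix.toLinAlgEquiv' (Polynomial.aeval A P) :=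
      Polynomial.aeval_algHom_apply (Matrix.toLinAlgEquiv' (R := ℂ) (n := Fin n)).toAlgHom A P
    have h2 : (Polynomial.aeval A P).trace = LinearMap.trace ℂ _ (Polynomial.aeval f P) := by
      rw [h1]; exact (Matrix.trace_toLin'_eq _).symm
    rw [h2, LinearMap.trace_eq_matrix_trace ℂ b]
    have := hpoly P
    rw [show LinearMap.toMatrix b b (Polynomial.aeval f P) = _ from this, Matrix.trace_diagonal]
  · have h2 : A.det = LinearMap.det f := (LinearMap.det_toLin' A).symm
    rw [h2, ← LinearMap.det_toMatrix b, show LinearMap.toMatrix b b f = _ from hmat,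
      Matrix.det_diagonal]

theorem Matrix.det_eq_pow_of_trace_pow {n n' m e : ℕ} (hm : 0 < m) {A : Matrix (Fin n) (Fin n) ℂ}
    {B : Matrix (Fin n') (Fin n') ℂ} (hA : A ^ m = 1) (hB : B ^ m = 1)
    (h : ∀ k : ℕ, (A ^ k).trace = e * (B ^ k).trace) : A.det = B.det ^ e := by
  obtain ⟨d, hd, htr, hdet⟩ := A.exists_diagonal_of_pow_eq_one hm hA
  obtain ⟨d', hd', htr', hdet'⟩ := B.exists_diagonal_of_pow_eq_one hm hB
  have hP : ∀ P : Polynomial ℂ, ∑ i, P.eval (d i) = e * ∑ i, P.eval (d' i) := fun P => by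
    rw [← htr, ← htr', Polynomial.aeval_eq_sum_range, Polynomial.aeval_eq_sum_range,
      Matrix.trace_sum, Matrix.trace_sum, Finset.mul_sum]
    refine Finset.sum_congr rfl fun k _ => ?_
    rw [Matrix.trace_smul, Matrix.trace_smul, h, smul_eq_mul, smul_eq_mul]
    ring
  let s : Finset ℂ := Finset.univ.image d ∪ Finset.univ.image d'
  have hcard : ∀ z, (Finset.univ.filter fun i => d i = z).card =
      e * (Finset.univ.filter fun i => d' i = z).card := fun z => by
    let P : Polynomial ℂ := Lagrange.interpolate s id (fun w => if w = z then 1 else 0)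
    have hev : ∀ w ∈ s, P.eval w = if w = z then 1 else 0 := fun w hw =>
      Lagrange.eval_interpolate_at_node (v := id) _ (Function.injective_id.injOn) hw
    have := hP P
    rw [Finset.sum_congr rfl fun i _ => hev (d i) (by simp [s]),
      Finset.sum_congr rfl fun i _ => hev (d' i) (by simp [s])] at this
    simp only [Finset.sum_boole] at this
    exact_mod_cast this
  have key : ∀ {k : ℕ} (c : Fin k → ℂ), (Finset.univ.image c ⊆ s) →
      ∏ i, c i = ∏ z ∈ s, z ^ (Finset.univ.filter fun i => c i = z).card := fun c hc => by
    rw [← Finset.prod_fiberwise_of_maps_to (s := Finset.univ) (t := s) (g := c)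
      fun i _ => hc (Finset.mem_image_of_mem _ (Finset.mem_univ i))]
    refine Finset.prod_congr rfl fun z _ => ?_
    rw [Finset.prod_congr rfl fun i hi => (Finset.mem_filter.1 hi).2, Finset.prod_const]
  rw [hdet, hdet', key d Finset.subset_union_left, key d' Finset.subset_union_right,
    ← Finset.prod_pow]
  exact Finset.prod_congr rfl fun z _ => by rw [hcard, mul_comm e, pow_mul]

end Diagonalization

section Degree

variable {G : Type} [Group G] [Fintype G]

theorem exists_eq_smul_one_of_commute {n : ℕ} (ρ : G →* Matrix (Fin n) (Fin n) ℂ)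
    (hρ : charForm (fun g => (ρ g).trace) (fun g => (ρ g).trace) = 1)
    (T : Matrix (Fin n) (Fin n) ℂ) (hT : ∀ g, T * ρ g = ρ g * T) : ∃ c : ℂ, T = c • 1 := by
  let τ : Representation ℂ G (Fin n → ℂ) :=
    (Matrix.toLinAlgEquiv' : Matrix (Fin n) (Fin n) ℂ ≃ₐ[ℂ] _).toAlgHom.toMonoidHom'.comp ρ
  have hch : ∀ g, τ.character g = (ρ g).trace := fun g => Matrix.trace_toLin'_eq (ρ g)
  have hfin := Representation.card_inv_mul_sum_char_mul_char_eq_finrank τ τ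
  have h1 : Module.finrank ℂ (Representation.IntertwiningMap τ τ) = 1 := by
    have : (Module.finrank ℂ (Representation.IntertwiningMap τ τ) : ℂ) = 1 := by
      rw [← hfin, ← hρ]
      simp only [charForm, hch]
    exact_mod_cast this
  have hone : (1 : Representation.IntertwiningMap τ τ) ≠ 0 := by
    intro h
    have : ∀ f : Representation.IntertwiningMap τ τ, f = 0 := fun f => by rw [← mul_one f, h, mul_zero]
    have : Subsingleton (Representation.IntertwiningMap τ τ) := ⟨fun a b => by rw [this a, this b]⟩
    rw [Module.finrank_zero_of_subsingleton] at h1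
    exact zero_ne_one h1
  let f : Representation.IntertwiningMap τ τ :=
    { toLinearMap := Matrix.toLinAlgEquiv' T
      isIntertwining' := fun g => by
        have := congrArg (Matrix.toLinAlgEquiv' (R := ℂ) (n := Fin n)) (hT g)
        rw [map_mul, map_mul] at this
        exact this }
  obtain ⟨c, hc⟩ := (finrank_eq_one_iff_of_nonzero' _ hone).1 h1 f
  refine ⟨c, (Matrix.toLinAlgEquiv' (R := ℂ) (n := Fin n)).injective ?_⟩
  rw [map_smul, map_one]
  exact (congrArg Representation.IntertwiningMap.toLinearMap hc).symm

theorem IsMatrixCharacter.isIntegral {χ : G → ℂ} (h : IsMatrixCharacter G χ) (g : G) :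
    IsIntegral ℤ (χ g) := by
  obtain ⟨n, ρ, hρ⟩ := h
  have hA : (ρ g) ^ Fintype.card G = 1 := by rw [← map_pow, pow_card_eq_one, map_one]
  obtain ⟨d, hd, htr, -⟩ := (ρ g).exists_diagonal_of_pow_eq_one Fintype.card_pos hA
  have := htr Polynomial.X
  rw [Polynomial.aeval_X] at this
  rw [hρ, this]
  refine IsIntegral.sum _ fun i _ => ?_
  rw [Polynomial.eval_X]
  exact IsIntegral.of_pow Fintype.card_pos (by rw [hd]; exact isIntegral_one)

omit [Fintype G] in
theorem IsMatrixCharacter.mem_Qfield {χ : G → ℂ} (h : IsMatrixCharacter G χ) {p a : ℕ}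
    (hp : 0 < p) {g : G} (hg : g ^ p ^ a = 1) : χ g ∈ Qfield p := by
  obtain ⟨n, ρ, hρ⟩ := h
  have hg' : g ^ p ^ (a + 1) = 1 := by rw [pow_succ, pow_mul, hg, one_pow]
  have hA : (ρ g) ^ p ^ (a + 1) = 1 := by rw [← map_pow, hg', map_one]
  obtain ⟨d, hd, htr, -⟩ := (ρ g).exists_diagonal_of_pow_eq_one (pow_pos hp _) hA
  have := htr Polynomial.X
  rw [Polynomial.aeval_X] at this
  rw [hρ, this]
  refine sum_mem fun i _ => ?_
  rw [Polynomial.eval_X]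
  exact Subfield.subset_closure ⟨a + 1, a.succ_pos, hd i⟩

theorem IsIrreducibleCharacter.exists_degree {χ : G → ℂ} (h : IsIrreducibleCharacter G χ) :
    ∃ d : ℕ, χ 1 = d ∧ d ∣ Fintype.card G := by
  obtain ⟨⟨n, ρ, hρ⟩, hnorm⟩ := isIrreducibleCharacter_iff.1 h
  have hχ : χ = fun g => (ρ g).trace := funext hρ
  have hconj := h.isMatrixCharacter.map_conj
  have hχ1 : χ 1 = n := by rw [hρ, map_one, Matrix.trace_one, Fintype.card_fin]
  refine ⟨n, hχ1, ?_⟩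
  let T : Matrix (Fin n) (Fin n) ℂ := ∑ g, χ g⁻¹ • ρ g
  obtain ⟨c, hc⟩ := exists_eq_smul_one_of_commute ρ (by rw [← hχ, hnorm]) T fun x => by
    simp only [T, Finset.sum_mul, Finset.mul_sum, smul_mul_assoc, mul_smul_comm, ← map_mul]
    refine Fintype.sum_equiv (MulAut.conj x⁻¹).toEquiv _ _ fun g => ?_
    simp only [MulEquiv.toEquiv_eq_coe, EquivLike.coe_coe, MulAut.conj_apply, inv_inv]
    rw [show (x⁻¹ * g * x)⁻¹ = x⁻¹ * g⁻¹ * (x⁻¹)⁻¹ by group, hconj]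
    congr 2
    group
  have htr : (Fintype.card G : ℂ) = c * n := by
    have := congrArg Matrix.trace hc
    simp only [T, Matrix.trace_sum, Matrix.trace_smul, ← hρ, Matrix.trace_one, smul_eq_mul,
      Fintype.card_fin] at this
    rw [← this]
    unfold charForm at hnorm
    rw [inv_mul_eq_one₀ (Nat.cast_ne_zero.mpr Nat.card_pos.ne'), Nat.card_eq_fintype_card] at hnorm
    rw [hnorm]
    exact Finset.sum_congr rfl fun g _ => mul_comm _ _
  have hn : (n : ℂ) ≠ 0 := fun h0 => by
    rw [h0, mul_zero] at htr
    exact Nat.cast_ne_zero.mpr Fintype.card_ne_zero htr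
  have hcInt : IsIntegral ℤ c := by
    let R := integralClosure ℤ ℂ
    let φ : MonoidAlgebra R G →ₐ[R] Matrix (Fin n) (Fin n) ℂ := MonoidAlgebra.lift R _ G ρ
    let z : MonoidAlgebra R G :=
      ∑ g, MonoidAlgebra.single g (⟨χ g⁻¹, h.isMatrixCharacter.isIntegral g⁻¹⟩ : R)
    have hz : φ z = T := by
      simp only [z, map_sum, φ, MonoidAlgebra.lift_single]
      rfl
    have : IsIntegral R z := Algebra.IsIntegral.isIntegral z
    have hT : IsIntegral R T := hz ▸ this.map φ
    rw [hc] at hT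
    have hcR : IsIntegral R c := by
      have hn' : n ≠ 0 := by exact_mod_cast hn
      have : Nonempty (Fin n) := ⟨⟨0, Nat.pos_of_ne_zero hn'⟩⟩
      let f : ℂ →ₐ[R] Matrix (Fin n) (Fin n) ℂ :=
        (Algebra.ofId ℂ (Matrix (Fin n) (Fin n) ℂ)).restrictScalars R
      refine (isIntegral_algHom_iff f (RingHom.injective f.toRingHom)).1 ?_
      rw [← Algebra.algebraMap_eq_smul_one] at hT
      exact hT
    exact isIntegral_trans (R := ℤ) (A := R) c hcR
  have hq : c = ((Fintype.card G / n : ℚ) : ℂ) := by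
    push_cast
    rw [eq_div_iff hn, htr]
  rw [hq] at hcInt
  have : IsIntegral ℤ (Fintype.card G / n : ℚ) := by
    rwa [← isIntegral_algebraMap_iff (B := ℂ) (algebraMap ℚ ℂ).injective]
  obtain ⟨k, hk⟩ := IsIntegrallyClosed.isIntegral_iff.1 this
  have : (Fintype.card G : ℚ) = k * n := by
    have hn'' : (n : ℚ) ≠ 0 := by exact_mod_cast hn
    field_simp at hk
    simpa [mul_comm] using hk.symm
  have h3 : (Fintype.card G : ℤ) = k * n := by exact_mod_cast this
  exact Int.natCast_dvd_natCast.1 ⟨k, by rw [h3, mul_comm]⟩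

end Degree

section Twist

theorem RingHom.exists_extension {R S L : Type} [CommRing R] [IsDomain R] [Field S] [Field L] [IsAlgClosed L]
    (i : R →+* S) (j : R →+* L) (hi : Function.Injective i) (hj : Function.Injective j)
    (h : ∀ s : S, ∃ P : Polynomial R, P ≠ 0 ∧ P.eval₂ i s = 0) :
    ∃ τ : S →+* L, ∀ r, τ (i r) = j r := by
  let := i.toAlgebra
  let := j.toAlgebra
  have : Algebra.IsAlgebraic R S := ⟨fun s => h s⟩
  have : FaithfulSMul R S := (faithfulSMul_iff_algebraMap_injective R S).2 hi
  have : FaithfulSMul R L := (faithfulSMul_iff_algebraMap_injective R L).2 hj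
  let τ : S →ₐ[R] L := IsAlgClosed.lift
  exact ⟨τ.toRingHom, fun r => τ.commutes r⟩

theorem exists_ringHom_ne {F : Subfield ℂ} {x : ℂ} (hx : IsIntegral ℤ x) (hxF : x ∉ F) :
    ∃ τ : ℂ →+* ℂ, (∀ a ∈ F, τ a = a) ∧ τ x ≠ x := by
  have hxi : IsIntegral F x := hx.tower_top
  have hsep : IsSeparable F x := (minpoly.irreducible hxi).separable
  obtain ⟨y, hne, hy⟩ := (notMem_iff_exists_ne_and_isConjRoot hsep (IsAlgClosed.splits _)).1
    (fun hm => by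
      obtain ⟨a, ha⟩ := Algebra.mem_bot.1 hm
      exact hxF (ha ▸ a.2))
  have hyi : IsIntegral F y := by
    by_contra hcon
    have := minpoly.eq_zero hcon
    rw [← (hy : minpoly F x = minpoly F y)] at this
    exact minpoly.ne_zero hxi this
  let E := algebraicClosure F ℂ
  let x' : E := ⟨x, mem_algebraicClosure_iff.2 hxi.isAlgebraic⟩
  let y' : E := ⟨y, mem_algebraicClosure_iff.2 hyi.isAlgebraic⟩
  have hnormal : Normal F E := IsAlgClosure.normal F E
  have hconj : IsConjRoot F y' x' := by
    have h1 : minpoly F x' = minpoly F x := (minpoly.algHom_eq E.val E.val.injective x').symm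
    have h2 : minpoly F y' = minpoly F y := (minpoly.algHom_eq E.val E.val.injective y').symm
    change minpoly F y' = minpoly F x'
    rw [h1, h2]
    exact (hy : minpoly F x = minpoly F y).symm
  obtain ⟨φ, hφ⟩ := hconj.exists_algEquiv
  obtain ⟨ι, t, ht⟩ := exists_isTranscendenceBasis' E ℂ
  let i : MvPolynomial ι E →+* ℂ := (MvPolynomial.aeval t : MvPolynomial ι E →ₐ[E] ℂ).toRingHom
  have hi : Function.Injective i := ht.1
  let j : MvPolynomial ι E →+* ℂ := i.comp (MvPolynomial.map (φ : E →+* E))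
  have hj : Function.Injective j :=
    hi.comp (MvPolynomial.map_injective _ φ.injective)
  obtain ⟨τ, hτ⟩ := RingHom.exists_extension i j hi hj fun s => by
    have := ht.isAlgebraic
    obtain ⟨P, hP, hev⟩ := this.1 s
    let e := ht.1.aevalEquiv
    refine ⟨P.map (e.symm : _ →+* MvPolynomial ι E), ?_, ?_⟩
    · rwa [Ne, Polynomial.map_eq_zero_iff e.symm.injective]
    · rw [Polynomial.eval₂_map, ← hev, Polynomial.aeval_def]
      congr 1
      ext a
      have : algebraMap _ ℂ (e (e.symm a)) = i (e.symm a) :=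
        ht.1.algebraMap_aevalEquiv (e.symm a)
      rw [AlgEquiv.apply_symm_apply] at this
      exact this.symm
  have hτE : ∀ a : E, τ a = φ a := fun a => by
    have := hτ (MvPolynomial.C a)
    simpa [i, j] using this
  refine ⟨τ, fun a ha => ?_, ?_⟩
  · have := hτE (algebraMap F E ⟨a, ha⟩)
    rw [AlgEquiv.commutes] at this
    exact this
  · have := hτE x'
    rw [hφ] at this
    change τ x = y at this
    rw [this]
    exact hne.symm

variable {G : Type} [Group G]

theorem IsMatrixCharacter.map {χ : G → ℂ} (h : IsMatrixCharacter G χ) (τ : ℂ →+* ℂ) :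
    IsMatrixCharacter G (fun g => τ (χ g)) := by
  obtain ⟨n, ρ, hρ⟩ := h
  exact ⟨n, (τ.mapMatrix (m := Fin n)).toMonoidHom.comp ρ, fun g => by
    simp only [hρ]; exact AddMonoidHom.map_trace τ.toAddMonoidHom (ρ g)⟩

theorem charForm_map [Fintype G] (τ : ℂ →+* ℂ) (a b : G → ℂ) :
    charForm (fun g => τ (a g)) (fun g => τ (b g)) = τ (charForm a b) := by
  simp [charForm]

theorem IsIrreducibleCharacter.map [Fintype G] {χ : G → ℂ} (h : IsIrreducibleCharacter G χ)
    (τ : ℂ →+* ℂ) : IsIrreducibleCharacter G (fun g => τ (χ g)) := by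
  rw [isIrreducibleCharacter_iff] at h ⊢
  exact ⟨h.1.map τ, by rw [charForm_map, h.2, map_one]⟩

end Twist

section Ambient

variable {G : Type} [Group G] [Fintype G]

/-- `a` restricted to the subgroup `H` is a class function of `H`. -/
def IsClassOn (H : Subgroup G) (a : G → ℂ) : Prop :=
  ∀ x ∈ H, ∀ g ∈ H, a (x * g * x⁻¹) = a g

/-- `a` restricted to the subgroup `H` is the character of a representation of `H`. -/
def IsMatrixOn (H : Subgroup G) (a : G → ℂ) : Prop :=
  IsMatrixCharacter H fun h => a h

/-- `a` vanishes outside the subgroup `H`. -/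
def IsSupportedOn (H : Subgroup G) (a : G → ℂ) : Prop :=
  ∀ g, g ∉ H → a g = 0

/-- The form `charForm` on the restrictions to a subgroup. -/
def subForm (H : Subgroup G) (a b : G → ℂ) : ℂ :=
  charForm (fun h : H => a h) fun h : H => b h

/-- Extension by zero of the irreducible characters of a subgroup. -/
def irr (H : Subgroup G) : Finset (G → ℂ) :=
  (irrChars H).image fun f g => if h : g ∈ H then f ⟨g, h⟩ else 0

theorem mem_irr {H : Subgroup G} {χ : G → ℂ} :
    χ ∈ irr H ↔ IsSupportedOn H χ ∧ IsIrreducibleCharacter H fun h => χ h := by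
  simp only [irr, Finset.mem_image, mem_irrChars]
  constructor
  · rintro ⟨f, hf, rfl⟩
    refine ⟨fun g hg => by simp [hg], ?_⟩
    convert hf with h
    simp
  · rintro ⟨h0, h1⟩
    refine ⟨_, h1, funext fun g => ?_⟩
    split_ifs with h
    · rfl
    · exact (h0 g h).symm

variable {H K T N : Subgroup G} {a b c χ η θ : G → ℂ}

theorem irr_ext (hχ : χ ∈ irr H) (hη : η ∈ irr H) (h : ∀ g ∈ H, χ g = η g) : χ = η :=
  funext fun g => if hg : g ∈ H then h g hg else by
    rw [(mem_irr.1 hχ).1 g hg, (mem_irr.1 hη).1 g hg]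

theorem subForm_comm (a b : G → ℂ) : subForm H a b = subForm H b a := charForm_comm _ _

theorem subForm_congr {a' b' : G → ℂ} (ha : ∀ g ∈ H, a g = a' g) (hb : ∀ g ∈ H, b g = b' g) :
    subForm H a b = subForm H a' b' := by
  have h1 : (fun h : H => a h) = fun h : H => a' h := funext fun h => ha h h.2
  have h2 : (fun h : H => b h) = fun h : H => b' h := funext fun h => hb h h.2
  rw [subForm, subForm, h1, h2]

theorem subForm_sum_left {ι : Type*} (s : Finset ι) (c : ι → ℂ) (f : ι → G → ℂ) (b : G → ℂ) :
    subForm H (fun g => ∑ i ∈ s, c i * f i g) b = ∑ i ∈ s, c i * subForm H (f i) b := by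
  have : (fun h : H => ∑ i ∈ s, c i * f i h) = ∑ i ∈ s, c i • fun h : H => f i h := by
    ext h; simp
  rw [subForm, this, charForm_sum_left]
  exact Finset.sum_congr rfl fun i _ => charForm_smul_left _ _ _

theorem subForm_smul_left (t : ℂ) (a b : G → ℂ) :
    subForm H (fun g => t * a g) b = t * subForm H a b := charForm_smul_left t _ _

theorem subForm_eq_ite (hχ : χ ∈ irr H) (hη : η ∈ irr H) :
    subForm H χ η = if χ = η then 1 else 0 := by
  rw [subForm, (mem_irr.1 hχ).2.charForm_eq_ite (mem_irr.1 hη).2]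
  refine if_congr ⟨fun h => irr_ext hχ hη fun g hg => congrFun h ⟨g, hg⟩, fun h => h ▸ rfl⟩ rfl rfl

theorem subForm_self (hχ : χ ∈ irr H) : subForm H χ χ = 1 := by
  rw [subForm_eq_ite hχ hχ, if_pos rfl]

omit [Fintype G] in
theorem IsMatrixOn.mono (h : IsMatrixOn H a) (hK : K ≤ H) : IsMatrixOn K a := by
  obtain ⟨n, ρ, hρ⟩ := h
  exact ⟨n, ρ.comp (Subgroup.inclusion hK), fun g => hρ (Subgroup.inclusion hK g)⟩

theorem isMatrixOn_of_mem_irr (h : χ ∈ irr H) : IsMatrixOn H χ := (mem_irr.1 h).2.isMatrixCharacter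

omit [Fintype G] in
theorem IsMatrixOn.isClassOn (h : IsMatrixOn H a) : IsClassOn H a := fun x hx g hg =>
  IsMatrixCharacter.map_conj h ⟨g, hg⟩ ⟨x, hx⟩

theorem IsMatrixOn.subForm_natCast (ha : IsMatrixOn H a) (hb : IsMatrixOn H b) :
    ∃ n : ℕ, subForm H a b = n := IsMatrixCharacter.charForm_natCast ha hb

theorem mem_irr_of_subForm_eq_one (h0 : IsSupportedOn H a) (h : IsMatrixOn H a)
    (h1 : subForm H a a = 1) : a ∈ irr H :=
  mem_irr.2 ⟨h0, isIrreducibleCharacter_iff.2 ⟨h, h1⟩⟩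

theorem exists_degree (h : χ ∈ irr H) : ∃ d : ℕ, χ 1 = d ∧ d ≠ 0 ∧ d ∣ Nat.card H := by
  obtain ⟨d, hd, hdvd⟩ := (mem_irr.1 h).2.exists_degree
  rw [← Nat.card_eq_fintype_card] at hdvd
  exact ⟨d, hd, fun h0 => Nat.card_pos.ne' (Nat.eq_zero_of_zero_dvd (h0 ▸ hdvd)), hdvd⟩

theorem IsClassOn.eq_sum (h : IsClassOn H a) {g : G} (hg : g ∈ H) :
    a g = ∑ χ ∈ irr H, subForm H a χ * χ g := by
  have := congrFun (eq_sum_charForm_smul (f := fun h : H => a h)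
    fun x g => h x x.2 g g.2) ⟨g, hg⟩
  rw [Finset.sum_apply] at this
  refine this.trans ?_
  rw [irr, Finset.sum_image]
  · refine Finset.sum_congr rfl fun f _ => ?_
    simp only [subForm, Pi.smul_apply, smul_eq_mul, SetLike.coe_mem, dite_true, hg]
  · intro f _ f' _ hff
    ext ⟨x, hx⟩
    simpa [hx] using congrFun hff x

theorem IsClassOn.subForm_eq_sum (h : IsClassOn H a) (hK : K ≤ H) (b : G → ℂ) :
    subForm K a b = ∑ χ ∈ irr H, subForm H a χ * subForm K χ b := by
  rw [← subForm_sum_left]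
  exact subForm_congr (fun g hg => h.eq_sum (hK hg)) fun _ _ => rfl

theorem sum_subgroup (H : Subgroup G) (f : G → ℂ) :
    ∑ h : H, f h = ∑ g : G, if g ∈ H then f g else 0 := by
  rw [← Finset.sum_filter]
  exact (Finset.sum_subtype (Finset.univ.filter fun g => g ∈ H) (by simp) f).symm

theorem card_mul_subForm (H : Subgroup G) (a b : G → ℂ) :
    (Nat.card H : ℂ) * subForm H a b = ∑ g : G, if g ∈ H then a g * b g⁻¹ else 0 := by
  rw [subForm, charForm, mul_inv_cancel_left₀ (Nat.cast_ne_zero.mpr Nat.card_pos.ne'),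
    ← sum_subgroup H fun g => a g * b g⁻¹]
  rfl

theorem IsSupportedOn.card_mul_subForm (h : IsSupportedOn K a) (hK : K ≤ H) (b : G → ℂ) :
    (Nat.card H : ℂ) * subForm H a b = Nat.card K * subForm K a b := by
  rw [_root_.card_mul_subForm, _root_.card_mul_subForm]
  refine Finset.sum_congr rfl fun g _ => ?_
  by_cases hg : g ∈ K
  · rw [if_pos hg, if_pos (hK hg)]
  · rw [if_neg hg, h g hg, zero_mul, ite_self]

/-- Every element of `T` normalizes `N`. -/
def Normalizes (T N : Subgroup G) : Prop :=
  ∀ x ∈ T, ∀ g, g ∈ N ↔ x * g * x⁻¹ ∈ N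

/-- The conjugate of a function. -/
def conjFun (x : G) (a : G → ℂ) : G → ℂ := fun g => a (x * g * x⁻¹)

theorem conjFun_mem_irr (hθ : θ ∈ irr N) {x : G} (hx : ∀ g, g ∈ N ↔ x * g * x⁻¹ ∈ N) :
    conjFun x θ ∈ irr N := by
  let e : N ≃* N :=
    { toFun := fun g => ⟨x * g * x⁻¹, (hx g).1 g.2⟩
      invFun := fun g => ⟨x⁻¹ * g * x, (hx _).2 (by simp [mul_assoc])⟩
      left_inv := fun g => by ext; simp [mul_assoc]
      right_inv := fun g => by ext; simp [mul_assoc]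
      map_mul' := fun g h => by ext; simp }
  obtain ⟨h0, h1⟩ := mem_irr.1 hθ
  rw [isIrreducibleCharacter_iff] at h1
  obtain ⟨⟨n, ρ, hρ⟩, h1⟩ := h1
  refine mem_irr_of_subForm_eq_one (fun g hg => h0 _ fun h => hg ((hx g).2 h))
    ⟨n, ρ.comp e.toMonoidHom, fun g => hρ (e g)⟩ ?_
  rw [← h1, subForm, charForm, charForm]
  congr 1
  refine Fintype.sum_equiv e.toEquiv _ _ fun g => ?_
  simp [conjFun, e, mul_assoc]

/-- The sum of the conjugates under a subgroup. -/
def sumConj (T : Subgroup G) (a : G → ℂ) : G → ℂ := fun g => ∑ x : T, a (x * g * (x : G)⁻¹)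

theorem sumConj_isClassOn (T : Subgroup G) (a : G → ℂ) : IsClassOn T (sumConj T a) := by
  intro x hx g _
  refine Fintype.sum_equiv (Equiv.mulRight (⟨x, hx⟩ : T)) _ _ fun y => ?_
  simp [mul_assoc]

/-- Frobenius reciprocity. -/
theorem subForm_sumConj (hK : K ≤ T) (hθ : IsSupportedOn K θ) (hχ : IsClassOn T χ) :
    subForm T (sumConj T θ) χ = Nat.card K * subForm K θ χ := by
  have hT : (Nat.card T : ℂ) ≠ 0 := Nat.cast_ne_zero.mpr Nat.card_pos.ne'
  rw [← hθ.card_mul_subForm hK]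
  simp only [subForm, charForm]
  rw [mul_inv_cancel_left₀ hT, inv_mul_eq_iff_eq_mul₀ hT]
  simp only [sumConj, Finset.sum_mul]
  rw [Finset.sum_comm]
  have : ∀ x : T, ∑ g : T, θ (x * g * (x : G)⁻¹) * χ ((g⁻¹ : T) : G) =
      ∑ g : T, θ g * χ ((g⁻¹ : T) : G) := fun x => by
    refine Fintype.sum_equiv (MulAut.conj x).toEquiv _ _ fun g => ?_
    have := hχ x x.2 (g⁻¹ : T) (g⁻¹ : T).2
    simp only [MulEquiv.toEquiv_eq_coe, EquivLike.coe_coe, MulAut.conj_apply, Subgroup.coe_mul,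
      Subgroup.coe_inv, mul_inv_rev, inv_inv, mul_assoc] at this ⊢
    rw [this]
  rw [Finset.sum_congr rfl fun x _ => this x, Finset.sum_const, Finset.card_univ,
    ← Nat.card_eq_fintype_card, nsmul_eq_mul]

theorem subForm_sumConj_right (hT : Normalizes T N) (hθ : θ ∈ irr N)
    (hη : η ∈ irr N) : subForm N (sumConj T θ) η =
      (Finset.univ.filter fun x : T => conjFun (x : G) θ = η).card := by
  have : subForm N (sumConj T θ) η = ∑ x : T, 1 * subForm N (conjFun (x : G) θ) η := by
    rw [← subForm_sum_left]
    exact subForm_congr (fun g _ => by simp [sumConj, conjFun]) fun _ _ => rfl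
  rw [this]
  simp only [one_mul]
  rw [Finset.sum_congr rfl fun (x : T) _ => subForm_eq_ite (conjFun_mem_irr hθ (hT x x.2)) hη]
  simp

theorem exists_irr_over (hK : K ≤ H) (hη : η ∈ irr K) : ∃ χ ∈ irr H, subForm K χ η ≠ 0 := by
  by_contra! hcon
  have h := (sumConj_isClassOn H η).eq_sum (one_mem H)
  rw [Finset.sum_eq_zero] at h
  · obtain ⟨d, hd, hd0, -⟩ := exists_degree hη
    simp [sumConj, hd, hd0] at h
  · intro χ hχ
    rw [subForm_sumConj hK (mem_irr.1 hη).1 (isMatrixOn_of_mem_irr hχ).isClassOn, subForm_comm,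
      hcon χ hχ, mul_zero, zero_mul]

end Ambient

section Multiplicity

theorem Finset.bilin_eq_of_le {ι : Type*} (I : Finset ι) (f : ι → ℕ) (B : ι → ι → ℕ)
    (hB : ∀ i ∈ I, f i ≠ 0 → B i i ≠ 0)
    (h : ∑ i ∈ I, ∑ i' ∈ I, f i * f i' * B i i' ≤ ∑ i ∈ I, f i ^ 2) :
    ∀ i ∈ I, ∀ i' ∈ I, f i * f i' * B i i' = if i = i' then f i ^ 2 else 0 := by
  have hle : ∀ x ∈ I ×ˢ I, (if x.1 = x.2 then f x.1 ^ 2 else 0) ≤ f x.1 * f x.2 * B x.1 x.2 := by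
    rintro ⟨i, i'⟩ hx
    dsimp only
    split_ifs with he
    · subst he
      by_cases h0 : f i = 0
      · simp [h0]
      · have := Nat.one_le_iff_ne_zero.2 (hB i (Finset.mem_product.1 hx).1 h0)
        rw [sq]
        exact Nat.le_mul_of_pos_right _ this
    · exact Nat.zero_le _
  have hs : ∑ x ∈ I ×ˢ I, (if x.1 = x.2 then f x.1 ^ 2 else 0) = ∑ i ∈ I, f i ^ 2 := by
    rw [Finset.sum_product]
    exact Finset.sum_congr rfl fun i hi => by simp [hi]
  have heq : ∑ x ∈ I ×ˢ I, (if x.1 = x.2 then f x.1 ^ 2 else 0) =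
      ∑ x ∈ I ×ˢ I, f x.1 * f x.2 * B x.1 x.2 :=
    le_antisymm (Finset.sum_le_sum hle) (by rw [hs, Finset.sum_product]; exact h)
  intro i hi i' hi'
  exact ((Finset.sum_eq_sum_iff_of_le hle).1 heq (i, i') (Finset.mk_mem_product hi hi')).symm

theorem Finset.rows_of_sum_sq_le {ι κ : Type*} (I : Finset ι) (J : Finset κ) (f : ι → ℕ)
    (A : ι → κ → ℕ) (hA : ∀ i ∈ I, f i ≠ 0 → ∃ j ∈ J, A i j ≠ 0)
    (h : ∑ j ∈ J, (∑ i ∈ I, f i * A i j) ^ 2 ≤ ∑ i ∈ I, f i ^ 2) :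
    (∀ i ∈ I, f i ≠ 0 → ∑ j ∈ J, A i j ^ 2 = 1) ∧
      ∀ i ∈ I, ∀ i' ∈ I, i ≠ i' → f i ≠ 0 → f i' ≠ 0 → ∀ j ∈ J, A i j * A i' j = 0 := by
  have key := Finset.bilin_eq_of_le I f (fun i i' => ∑ j ∈ J, A i j * A i' j)
    (fun i hi hf h0 => by
      obtain ⟨j, hj, hne⟩ := hA i hi hf
      exact hne (mul_self_eq_zero.1 (Finset.sum_eq_zero_iff.1 h0 j hj))) (by
    refine le_trans (le_of_eq ?_) h
    symm
    calc ∑ j ∈ J, (∑ i ∈ I, f i * A i j) ^ 2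
        = ∑ j ∈ J, ∑ i ∈ I, ∑ i' ∈ I, f i * f i' * (A i j * A i' j) :=
          Finset.sum_congr rfl fun j _ => by
            rw [sq, Finset.sum_mul_sum]
            exact Finset.sum_congr rfl fun i _ => Finset.sum_congr rfl fun i' _ => by ring
      _ = ∑ i ∈ I, ∑ i' ∈ I, f i * f i' * ∑ j ∈ J, A i j * A i' j := by
          rw [Finset.sum_comm]
          refine Finset.sum_congr rfl fun i _ => ?_
          rw [Finset.sum_comm]
          exact Finset.sum_congr rfl fun i' _ => by rw [Finset.mul_sum])
  constructor
  · intro i hi hf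
    have := key i hi i hi
    rw [if_pos rfl, ← sq] at this
    simpa only [sq] using Nat.eq_of_mul_eq_mul_left (by positivity) (this.trans (mul_one _).symm)
  · intro i hi i' hi' hne hf hf' j hj
    have := key i hi i' hi'
    rw [if_neg hne, mul_eq_zero, or_iff_right (mul_ne_zero hf hf')] at this
    exact Finset.sum_eq_zero_iff.1 this j hj

variable {G : Type} [Group G] [Fintype G] {H K T T' N : Subgroup G} {a b χ η θ ψ : G → ℂ}

/-- The multiplicity of `η` in the restriction of `χ` to `K`. -/
def mult (K : Subgroup G) (χ η : G → ℂ) : ℕ := ⌊(subForm K χ η).re⌋₊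

theorem mult_eq {n : ℕ} (h : subForm K χ η = n) : mult K χ η = n := by
  simp [mult, h]

theorem coe_mult_of_isMatrixOn (h : IsMatrixOn K a) (hb : IsMatrixOn K b) :
    (mult K a b : ℂ) = subForm K a b := by
  obtain ⟨n, hn⟩ := h.subForm_natCast hb
  rw [mult_eq hn, hn]

theorem coe_mult (hχ : χ ∈ irr H) (hK : K ≤ H) (hη : η ∈ irr K) :
    (mult K χ η : ℂ) = subForm K χ η :=
  coe_mult_of_isMatrixOn ((isMatrixOn_of_mem_irr hχ).mono hK) (isMatrixOn_of_mem_irr hη)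

theorem mult_comm : mult K a b = mult K b a := by rw [mult, mult, subForm_comm]

theorem exists_mult_ne_zero (hK : K ≤ H) (hη : η ∈ irr K) : ∃ χ ∈ irr H, mult K χ η ≠ 0 := by
  obtain ⟨χ, hχ, h⟩ := exists_irr_over hK hη
  exact ⟨χ, hχ, fun h0 => h (by rw [← coe_mult hχ hK hη, h0, Nat.cast_zero])⟩

theorem sum_mult_mul_mult_of_isMatrixOn (ha : IsMatrixOn H a) (hK : K ≤ H) (hb : IsMatrixOn K b) :
    mult K a b = ∑ ψ ∈ irr H, mult H a ψ * mult K ψ b := by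
  have h := ha.isClassOn.subForm_eq_sum hK b
  apply mult_eq
  rw [h]
  push_cast
  refine Finset.sum_congr rfl fun ψ hψ => ?_
  rw [coe_mult_of_isMatrixOn ha (isMatrixOn_of_mem_irr hψ),
    coe_mult_of_isMatrixOn ((isMatrixOn_of_mem_irr hψ).mono hK) hb]

theorem sum_mult_sq (ha : IsMatrixOn H a) : mult H a a = ∑ ψ ∈ irr H, mult H a ψ ^ 2 := by
  rw [sum_mult_mul_mult_of_isMatrixOn ha le_rfl ha]
  exact Finset.sum_congr rfl fun ψ _ => by rw [mult_comm (a := ψ), sq]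

theorem exists_mult_ne_zero_of_isMatrixOn (ha : IsMatrixOn H a) {g : G} (hg : g ∈ H)
    (h : a g ≠ 0) : ∃ ψ ∈ irr H, mult H a ψ ≠ 0 := by
  by_contra! hcon
  apply h
  rw [ha.isClassOn.eq_sum hg]
  refine Finset.sum_eq_zero fun ψ hψ => ?_
  rw [← coe_mult_of_isMatrixOn ha (isMatrixOn_of_mem_irr hψ), hcon ψ hψ, Nat.cast_zero, zero_mul]

theorem mult_self_ne_zero (ha : IsMatrixOn H a) {g : G} (hg : g ∈ H) (h : a g ≠ 0) :
    mult H a a ≠ 0 := by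
  rw [sum_mult_sq ha]
  obtain ⟨ψ, hψ, hne⟩ := exists_mult_ne_zero_of_isMatrixOn ha hg h
  exact fun h0 => hne (pow_eq_zero_iff two_ne_zero |>.1 (Finset.sum_eq_zero_iff.1 h0 ψ hψ))

theorem apply_one_ne_zero (hχ : χ ∈ irr H) : χ 1 ≠ 0 := by
  obtain ⟨d, hd, hd0, -⟩ := exists_degree hχ
  rw [hd]
  exact_mod_cast hd0

/-- A character with irreducible restriction is irreducible. -/
theorem subForm_eq_one_of_restrict (ha : IsMatrixOn H a) (hK : K ≤ H) (h1 : subForm K a a = 1) :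
    subForm H a a = 1 := by
  have hm : mult K a a = 1 := mult_eq (by rw [h1, Nat.cast_one])
  have hne : ∃ g ∈ H, a g ≠ 0 := by
    by_contra! hcon
    rw [subForm_congr (a' := fun _ => 0) (b' := fun _ => 0) (fun g hg => hcon g (hK hg))
      fun g hg => hcon g (hK hg)] at h1
    unfold subForm charForm at h1
    simp at h1
  obtain ⟨g, hg, hne⟩ := hne
  have h0 := mult_self_ne_zero ha hg hne
  rw [← coe_mult_of_isMatrixOn ha ha]
  suffices mult H a a ≤ 1 by
    rw [show mult H a a = 1 by omega, Nat.cast_one]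
  have hexp : mult K a a = ∑ χ ∈ irr H, ∑ χ' ∈ irr H, mult H a χ * mult H a χ' * mult K χ χ' := by
    rw [sum_mult_mul_mult_of_isMatrixOn ha hK (ha.mono hK)]
    refine Finset.sum_congr rfl fun χ hχ => ?_
    rw [mult_comm (a := χ), sum_mult_mul_mult_of_isMatrixOn ha hK
      ((isMatrixOn_of_mem_irr hχ).mono hK), Finset.mul_sum]
    refine Finset.sum_congr rfl fun χ' _ => ?_
    rw [mult_comm (a := χ')]
    ring
  by_contra! hgt
  have hB : ∀ χ ∈ irr H, mult H a χ ≠ 0 → mult K χ χ ≠ 0 := fun χ hχ _ =>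
    mult_self_ne_zero ((isMatrixOn_of_mem_irr hχ).mono hK) (one_mem K) (apply_one_ne_zero hχ)
  have key := Finset.bilin_eq_of_le (irr H) (mult H a) (mult K) hB
    (by rw [← hexp, hm, ← sum_mult_sq ha]; omega)
  have : mult K a a = mult H a a := by
    rw [hexp, sum_mult_sq ha]
    refine Finset.sum_congr rfl fun χ hχ => ?_
    rw [Finset.sum_congr rfl (key χ hχ)]
    refine (Finset.sum_eq_single χ (fun b _ hb => ?_) fun h => absurd hχ h).trans ?_
    · exact if_neg hb.symm
    · exact if_pos rfl
  omega

theorem card_mul_sum_mult (hN : N ≤ T) (hT : Normalizes T N) (hθ : θ ∈ irr N) (hη : η ∈ irr N) :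
    Nat.card N * ∑ χ ∈ irr T, mult N χ θ * mult N χ η =
      (Finset.univ.filter fun x : T => conjFun (x : G) η = θ).card := by
  have hNc : (Nat.card N : ℂ) ≠ 0 := Nat.cast_ne_zero.mpr Nat.card_pos.ne'
  have h1 := subForm_sumConj hN (mem_irr.1 hθ).1 (sumConj_isClassOn T η)
  rw [subForm_comm θ, subForm_sumConj_right hT hη hθ,
    (sumConj_isClassOn T θ).subForm_eq_sum le_rfl] at h1
  have h2 : ∀ χ ∈ irr T, subForm T (sumConj T θ) χ * subForm T χ (sumConj T η) =
      (Nat.card N : ℂ) * (Nat.card N * (mult N χ θ * mult N χ η)) := fun χ hχ => by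
    have hcl := (isMatrixOn_of_mem_irr hχ).isClassOn
    rw [subForm_comm χ, subForm_sumConj hN (mem_irr.1 hθ).1 hcl,
      subForm_sumConj hN (mem_irr.1 hη).1 hcl, subForm_comm θ, subForm_comm η,
      coe_mult hχ hN hθ, coe_mult hχ hN hη]
    ring
  rw [Finset.sum_congr rfl h2, ← Finset.mul_sum, ← Finset.mul_sum] at h1
  exact_mod_cast mul_left_cancel₀ hNc h1

/-- Clifford's theorem. -/
theorem exists_conjFun_eq (hN : N ≤ T) (hT : Normalizes T N) (hχ : χ ∈ irr T) (hθ : θ ∈ irr N)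
    (hη : η ∈ irr N) (h1 : mult N χ θ ≠ 0) (h2 : mult N χ η ≠ 0) :
    ∃ x : T, conjFun (x : G) η = θ := by
  have h := card_mul_sum_mult hN hT hθ hη
  by_contra! hcon
  rw [Finset.card_eq_zero.2 (Finset.filter_eq_empty_iff.2 fun x _ => hcon x), mul_eq_zero,
    or_iff_right Nat.card_pos.ne', Finset.sum_eq_zero_iff] at h
  exact mul_ne_zero h1 h2 (h χ hχ)

theorem card_mul_sum_mult_sq (hN : N ≤ T) (hT : Normalizes T N) (hθ : θ ∈ irr N)
    (hT' : T' ≤ T) (hst : ∀ x ∈ T, conjFun x θ = θ ↔ x ∈ T') :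
    Nat.card N * ∑ χ ∈ irr T, mult N χ θ ^ 2 = Nat.card T' := by
  simp only [sq]
  rw [card_mul_sum_mult hN hT hθ hθ, ← Nat.card_congr (Subgroup.subgroupOfEquivOfLe hT').toEquiv,
    Nat.card_eq_fintype_card, Fintype.card_subtype]
  congr 1
  ext x
  simp [hst x x.2, Subgroup.mem_subgroupOf]

theorem eq_of_mult_stabilizer_ne_zero (hN : N ≤ T') (hT' : T' ≤ T) (hT : Normalizes T N)
    (hθ : θ ∈ irr N) (hst : ∀ x ∈ T, conjFun x θ = θ ↔ x ∈ T') (hψ : ψ ∈ irr T')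
    (hψθ : mult N ψ θ ≠ 0) {χ χ' : G → ℂ} (hχ : χ ∈ irr T) (hχ' : χ' ∈ irr T)
    (h : mult T' χ ψ ≠ 0) (h' : mult T' χ' ψ ≠ 0) : χ = χ' := by
  have h1 := card_mul_sum_mult_sq (hN.trans hT') hT hθ hT' hst
  have h2 := card_mul_sum_mult_sq hN (fun x hx => hT x (hT' hx)) hθ le_rfl
    fun x hx => hst x (hT' hx)
  have h3 := Nat.eq_of_mul_eq_mul_left Nat.card_pos (h1.trans h2.symm)
  have hrow := (Finset.rows_of_sum_sq_le (irr T') (irr T) (fun ψ => mult N ψ θ)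
    (fun ψ χ => mult T' χ ψ) (fun ψ hψ _ => exists_mult_ne_zero hT' hψ) (by
      rw [← h3]
      refine le_of_eq (Finset.sum_congr rfl fun χ hχ => ?_)
      rw [sum_mult_mul_mult_of_isMatrixOn ((isMatrixOn_of_mem_irr hχ).mono hT') hN
        (isMatrixOn_of_mem_irr hθ)]
      congr 1
      exact Finset.sum_congr rfl fun ψ _ => mul_comm _ _)).1 ψ hψ hψθ
  by_contra hne
  have : ∑ x ∈ {χ, χ'}, mult T' x ψ ^ 2 ≤ 1 := by
    rw [← hrow]
    exact Finset.sum_le_sum_of_subset (by simp [Finset.insert_subset_iff, hχ, hχ'])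
  rw [Finset.sum_pair hne] at this
  have e1 : 0 < mult T' χ ψ ^ 2 := by positivity
  have e2 : 0 < mult T' χ' ψ ^ 2 := by positivity
  omega

theorem mult_trans_ne_zero (hN : N ≤ T') (hT' : T' ≤ T) (hθ : θ ∈ irr N) (hψ : ψ ∈ irr T')
    (hχ : χ ∈ irr T) (h : mult N ψ θ ≠ 0) (h' : mult T' χ ψ ≠ 0) : mult N χ θ ≠ 0 := by
  rw [sum_mult_mul_mult_of_isMatrixOn ((isMatrixOn_of_mem_irr hχ).mono hT') hN
        (isMatrixOn_of_mem_irr hθ)]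
  exact fun h0 => mul_ne_zero h' h (Finset.sum_eq_zero_iff.1 h0 ψ hψ)

end Multiplicity

section Good

variable {G : Type} [Group G] [Fintype G] {H K M T N P : Subgroup G} {a b χ η θ ψ : G → ℂ} {p : ℕ}

theorem map_mem_irr (τ : ℂ →+* ℂ) (hχ : χ ∈ irr H) : (fun g => τ (χ g)) ∈ irr H :=
  mem_irr.2 ⟨fun g hg => (congrArg τ ((mem_irr.1 hχ).1 g hg)).trans (map_zero τ), (mem_irr.1 hχ).2.map τ⟩

theorem mult_map (τ : ℂ →+* ℂ) (ha : IsMatrixOn K a) (hb : IsMatrixOn K b) :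
    mult K (fun g => τ (a g)) (fun g => τ (b g)) = mult K a b := by
  apply mult_eq
  rw [subForm, charForm_map]
  change τ (subForm K a b) = _
  rw [← coe_mult_of_isMatrixOn ha hb, map_natCast]

theorem mult_congr {a' b' : G → ℂ} (ha : ∀ g ∈ K, a g = a' g) (hb : ∀ g ∈ K, b g = b' g) :
    mult K a b = mult K a' b' := by
  rw [mult, mult, subForm_congr ha hb]

/-- `a` is fixed by the endomorphisms of `ℂ` over `Qfield p`. -/
def IsFixedOver (p : ℕ) (a : G → ℂ) : Prop :=
  ∀ τ : ℂ →+* ℂ, (∀ x ∈ Qfield p, τ x = x) → (fun g => τ (a g)) = a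

/-- `a` is afforded by a representation of `N` whose determinant has `p`-power order. -/
def HasPrimePowerDet (p : ℕ) (N : Subgroup G) (a : G → ℂ) : Prop :=
  ∃ (d : ℕ) (ρ : N →* Matrix (Fin d) (Fin d) ℂ), (∀ g : N, a g = (ρ g).trace) ∧
    ∃ b : ℕ, ∀ g, (ρ g).det ^ p ^ b = 1

/-- The characters to which Galois-invariant extension arguments apply. -/
structure IsGood (p : ℕ) (N : Subgroup G) (θ : G → ℂ) : Prop where
  mem : θ ∈ irr N
  isFixedOver : IsFixedOver p θ
  hasPrimePowerDet : HasPrimePowerDet p N θ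
  exists_restrict : ∃ P ≤ N, IsPGroup p P ∧ subForm P θ θ = 1

theorem det_inclusion_eq_pow {n n' e : ℕ} (ρ : M →* Matrix (Fin n) (Fin n) ℂ)
    (σ : N →* Matrix (Fin n') (Fin n') ℂ) (hN : N ≤ M)
    (h : ∀ g : N, (ρ (Subgroup.inclusion hN g)).trace = e * (σ g).trace) (g : N) :
    (ρ (Subgroup.inclusion hN g)).det = (σ g).det ^ e := by
  have hg : g ^ Nat.card N = 1 := pow_card_eq_one'
  refine Matrix.det_eq_pow_of_trace_pow (m := Nat.card N) Nat.card_pos ?_ ?_ fun k => ?_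
  · rw [← map_pow, ← map_pow, hg, map_one, map_one]
  · rw [← map_pow, hg, map_one]
  · rw [← map_pow, ← map_pow, ← map_pow, h]

theorem apply_eq_mult_mul (hN : N ≤ M) (hM : Normalizes M N) (hθ : θ ∈ irr N)
    (hinv : ∀ x ∈ M, conjFun x θ = θ) (hψ : ψ ∈ irr M) (h : mult N ψ θ ≠ 0) {g : G} (hg : g ∈ N) :
    ψ g = mult N ψ θ * θ g := by
  rw [((isMatrixOn_of_mem_irr hψ).mono hN).isClassOn.eq_sum hg, coe_mult hψ hN hθ]
  refine Finset.sum_eq_single θ (fun η hη hne => ?_) fun h => absurd hθ h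
  rw [← coe_mult hψ hN hη]
  by_cases h0 : mult N ψ η = 0
  · rw [h0, Nat.cast_zero, zero_mul]
  · obtain ⟨x, hx⟩ := exists_conjFun_eq hN hM hψ hη hθ h0 h
    rw [hinv x x.2] at hx
    exact absurd hx.symm hne

theorem HasPrimePowerDet.of_pow_mem (hN : N ≤ M) (hM : Normalizes M N)
    (hθ : θ ∈ irr N) (hinv : ∀ x ∈ M, conjFun x θ = θ) (hψ : ψ ∈ irr M) (h : mult N ψ θ ≠ 0)
    (hdet : HasPrimePowerDet p N θ) (hpow : ∀ m ∈ M, m ^ p ∈ N) : HasPrimePowerDet p M ψ := by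
  obtain ⟨n, ρ, hρ⟩ := isMatrixOn_of_mem_irr hψ
  obtain ⟨n', σ, hσ, b, hb⟩ := hdet
  refine ⟨n, ρ, hρ, b + 1, fun g => ?_⟩
  have h1 := det_inclusion_eq_pow ρ σ hN (e := mult N ψ θ) (fun g => by
    rw [← hρ, ← hσ, ← apply_eq_mult_mul hN hM hθ hinv hψ h g.2]
    rfl) ⟨_, hpow g g.2⟩
  have h2 : Subgroup.inclusion hN ⟨_, hpow g g.2⟩ = g ^ p := by ext; simp
  rw [h2, map_pow, Matrix.det_pow] at h1
  rw [pow_succ', pow_mul, h1, ← pow_mul, mul_comm, pow_mul, hb, one_pow]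

theorem sum_mult_sq_of_invariant (hN : N ≤ M) (hM : Normalizes M N) (hθ : θ ∈ irr N)
    (hinv : ∀ x ∈ M, conjFun x θ = θ) :
    Nat.card N * ∑ χ ∈ irr M, mult N χ θ ^ 2 = Nat.card M :=
  card_mul_sum_mult_sq hN hM hθ le_rfl fun x hx => ⟨fun _ => hx, fun _ => hinv x hx⟩

theorem exists_sylow_of_relIndex [Fact p.Prime] (hN : N ≤ M) {Q : Subgroup G} (hQ : Q ≤ N)
    (hQp : IsPGroup p Q) {s : ℕ} (hs : Nat.card M = Nat.card N * p ^ s) :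
    ∃ P ≤ M, Q ≤ P ∧ IsPGroup p P ∧ Nat.card P * Nat.card N = Nat.card M * Nat.card ↥(P ⊓ N) := by
  have hQ' : IsPGroup p (Q.subgroupOf M) :=
    hQp.of_equiv (Subgroup.subgroupOfEquivOfLe (hQ.trans hN)).symm
  obtain ⟨S, hS⟩ := hQ'.exists_le_sylow
  have hcard : Nat.card ((S : Subgroup M).map M.subtype) = Nat.card S :=
    (Nat.card_congr ((S : Subgroup M).equivMapOfInjective M.subtype
      M.subtype_injective).toEquiv).symm
  refine ⟨(S : Subgroup M).map M.subtype, Subgroup.map_subtype_le _, ?_, S.2.map _, ?_⟩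
  · intro x hx
    exact ⟨⟨x, hN (hQ hx)⟩, hS (Subgroup.mem_subgroupOf.2 hx), rfl⟩
  · set P := (S : Subgroup M).map M.subtype
    have hPp : IsPGroup p P := S.2.map _
    obtain ⟨k, hk⟩ := (hPp.to_le (inf_le_left : P ⊓ N ≤ P)).exists_card_eq
    have h1 : Nat.card ↥(P ⊓ N) * p ^ s ≤ Nat.card P := by
      refine Nat.le_of_dvd Nat.card_pos ?_
      rw [hcard, S.card_eq_multiplicity, hk, ← pow_add]
      refine pow_dvd_pow _ ((Nat.Prime.pow_dvd_iff_le_factorization Fact.out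
        Nat.card_pos.ne').1 ?_)
      rw [pow_add, ← hk, hs]
      exact mul_dvd_mul_right (Subgroup.card_dvd_of_le inf_le_right) _
    have h2 : N.relIndex M = p ^ s := by
      have := Subgroup.card_mul_index (N.subgroupOf M)
      rw [Nat.card_congr (Subgroup.subgroupOfEquivOfLe hN).toEquiv, hs] at this
      exact Nat.eq_of_mul_eq_mul_left Nat.card_pos this
    have h3 : N.relIndex P ≤ p ^ s := by
      rw [← h2]
      exact Subgroup.relIndex_le_of_le_right (Subgroup.map_subtype_le _)
        (by rw [h2]; exact pow_ne_zero _ (Fact.out : p.Prime).ne_zero)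
    have h4 : Nat.card ↥(P ⊓ N) * N.relIndex P = Nat.card P := by
      have := Subgroup.card_mul_index ((P ⊓ N).subgroupOf P)
      rw [Nat.card_congr (Subgroup.subgroupOfEquivOfLe inf_le_left).toEquiv] at this
      rwa [← Subgroup.relIndex, Subgroup.inf_relIndex_left] at this
    have h5 : Nat.card P = Nat.card ↥(P ⊓ N) * p ^ s :=
      le_antisymm (h4 ▸ Nat.mul_le_mul_left _ h3) h1
    rw [h5, hs]
    ring

theorem IsGood.of_pow_mem (hp : p.Prime) (hN : N ≤ M) (hM : Normalizes M N) (hθ : IsGood p N θ)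
    (hinv : ∀ x ∈ M, conjFun x θ = θ) (hpow : ∀ m ∈ M, m ^ p ∈ N) {s : ℕ}
    (hs : Nat.card M = Nat.card N * p ^ s) (hψ : ψ ∈ irr M) (h : mult N ψ θ ≠ 0) :
    IsGood p M ψ := by
  have : Fact p.Prime := ⟨hp⟩
  obtain ⟨Q, hQN, hQp, hQ1⟩ := hθ.exists_restrict
  obtain ⟨P, hPM, hQP, hPp, hcard⟩ := exists_sylow_of_relIndex hN hQN hQp hs
  have hθN := hθ.mem
  set θ' : G → ℂ := fun g => if g ∈ P then θ g else 0 with hθ'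
  have hθ'P : ∀ g ∈ P ⊓ N, θ' g = θ g := fun g hg => if_pos hg.1
  have hθ'irr : θ' ∈ irr (P ⊓ N) := by
    have hθP : IsMatrixOn (P ⊓ N) θ := (isMatrixOn_of_mem_irr hθN).mono inf_le_right
    refine mem_irr_of_subForm_eq_one (fun g hg => ?_) ?_ ?_
    · by_cases hgP : g ∈ P
      · rw [hθ']
        exact (if_pos hgP).trans ((mem_irr.1 hθN).1 g fun h => hg ⟨hgP, h⟩)
      · exact if_neg hgP
    · obtain ⟨n, ρ, hρ⟩ := hθP
      exact ⟨n, ρ, fun g => (hθ'P g g.2).trans (hρ g)⟩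
    · rw [subForm_congr hθ'P hθ'P]
      exact subForm_eq_one_of_restrict hθP (le_inf hQP hQN) hQ1
  have hPK : Normalizes P (P ⊓ N) := fun x hx g => by
    rw [Subgroup.mem_inf, Subgroup.mem_inf, ← hM x (hPM hx) g]
    refine and_congr_left fun _ => ⟨fun hg => mul_mem (mul_mem hx hg) (inv_mem hx), fun hg => ?_⟩
    simpa [mul_assoc] using mul_mem (mul_mem (inv_mem hx) hg) hx
  have hinv' : ∀ x ∈ P, conjFun x θ' = θ' := fun x hx => funext fun g => by
    by_cases hg : g ∈ P ⊓ N
    · rw [conjFun, hθ'P _ ((hPK x hx g).1 hg), hθ'P g hg]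
      exact congrFun (hinv x (hPM hx)) g
    · rw [conjFun, (mem_irr.1 hθ'irr).1 g hg,
        (mem_irr.1 hθ'irr).1 _ fun h => hg ((hPK x hx g).2 h)]
  have hcl : IsClassOn M θ := fun x hx g _ => congrFun (hinv x hx) g
  have hsum : ∀ η ∈ irr P,
      ∑ χ ∈ irr M, mult N χ θ * mult P χ η = mult (P ⊓ N) η θ' := fun η hη => by
    have e1 : (Nat.card P : ℂ) * subForm P θ η = Nat.card ↥(P ⊓ N) * subForm (P ⊓ N) θ' η := by
      rw [← (mem_irr.1 hθ'irr).1.card_mul_subForm inf_le_left]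
      congr 1
      exact subForm_congr (fun g hg => (if_pos hg).symm) fun _ _ => rfl
    have e2 : (Nat.card M : ℂ) * subForm P θ η =
        Nat.card N * ∑ χ ∈ irr M, (mult N χ θ : ℂ) * mult P χ η := by
      rw [hcl.subForm_eq_sum hPM, Finset.mul_sum, Finset.mul_sum]
      refine Finset.sum_congr rfl fun χ hχ => ?_
      rw [← mul_assoc, (mem_irr.1 hθN).1.card_mul_subForm hN, coe_mult hχ hN hθN,
        coe_mult hχ hPM hη, subForm_comm θ, mul_assoc]
    have e3 : (Nat.card P * Nat.card N : ℂ) = Nat.card M * Nat.card ↥(P ⊓ N) := by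
      exact_mod_cast hcard
    rw [← Nat.cast_inj (R := ℂ)]
    push_cast
    rw [coe_mult hη inf_le_left hθ'irr, subForm_comm η]
    have hne : (Nat.card P * Nat.card N : ℂ) ≠ 0 := by
      exact_mod_cast (mul_pos Nat.card_pos Nat.card_pos).ne'
    refine mul_left_cancel₀ hne ?_
    rw [mul_assoc, ← e2, mul_left_comm, e1, e3, mul_assoc]
  have hrow := Finset.rows_of_sum_sq_le (irr M) (irr P) (fun χ => mult N χ θ) (mult P)
    (fun χ hχ _ => exists_mult_ne_zero_of_isMatrixOn ((isMatrixOn_of_mem_irr hχ).mono hPM)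
      (one_mem P) (apply_one_ne_zero hχ)) (by
      refine Nat.le_of_mul_le_mul_left (c := Nat.card P * Nat.card N) ?_
        (mul_pos Nat.card_pos Nat.card_pos)
      have e1 : ∑ η ∈ irr P, (∑ χ ∈ irr M, mult N χ θ * mult P χ η) ^ 2 =
          ∑ η ∈ irr P, mult (P ⊓ N) η θ' ^ 2 :=
        Finset.sum_congr rfl fun η hη => by rw [hsum η hη]
      have e2 := sum_mult_sq_of_invariant inf_le_left hPK hθ'irr hinv'
      have e3 := sum_mult_sq_of_invariant hN hM hθN hinv
      refine le_of_eq ?_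
      rw [mul_assoc _ _ (∑ χ ∈ irr M, mult N χ θ ^ 2), e3, e1, hcard, mul_assoc, e2, mul_comm])
  have hψP := hrow.1 ψ hψ h
  refine ⟨hψ, fun τ hτ => ?_,
    hθ.hasPrimePowerDet.of_pow_mem hN hM hθN hinv hψ h hpow, P, hPM, hPp, ?_⟩
  · by_contra hne
    have hτψ := map_mem_irr τ hψ
    have hτθ : mult N (fun g => τ (ψ g)) θ = mult N ψ θ := by
      conv_lhs => rw [← hθ.isFixedOver τ hτ]
      exact mult_map τ ((isMatrixOn_of_mem_irr hψ).mono hN) (isMatrixOn_of_mem_irr hθN)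
    have hP : ∀ g ∈ P, τ (ψ g) = ψ g := fun g hg => by
      obtain ⟨k, hk⟩ := hPp ⟨g, hg⟩
      exact hτ _ (IsMatrixCharacter.mem_Qfield ((isMatrixOn_of_mem_irr hψ).mono hPM) hp.pos hk)
    have hz := hrow.2 _ hτψ ψ hψ hne (by rwa [hτθ]) h
    have : ∑ η ∈ irr P, mult P ψ η ^ 2 = 0 := Finset.sum_eq_zero fun η hη => by
      have := hz η hη
      rwa [mult_congr hP fun _ _ => rfl, ← sq] at this
    omega
  · have hm := (isMatrixOn_of_mem_irr hψ).mono hPM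
    rw [← coe_mult_of_isMatrixOn hm hm, sum_mult_sq hm, hψP, Nat.cast_one]

end Good

section CoprimeStep

variable {G : Type} [Group G] [Fintype G] {L M N : Subgroup G} {χ θ ψ : G → ℂ} {p r : ℕ}

omit [Fintype G] in
theorem normal_subgroupOf (hM : Normalizes M N) : (N.subgroupOf M).Normal :=
  ⟨fun g hg x => (hM x x.2 g).1 hg⟩

omit [Fintype G] in
theorem card_mul_relIndex (hN : N ≤ M) : Nat.card N * N.relIndex M = Nat.card M := by
  rw [← Nat.card_congr (Subgroup.subgroupOfEquivOfLe hN).toEquiv]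
  exact Subgroup.card_mul_index (N.subgroupOf M)

omit [Fintype G] in
theorem normalizes_of_commutator_mem (hN : N ≤ L) (hL : L ≤ M)
    (hcomm : ∀ x ∈ M, ∀ y ∈ M, x * y * x⁻¹ * y⁻¹ ∈ N) : Normalizes M L := by
  have h : ∀ x ∈ M, ∀ g ∈ L, x * g * x⁻¹ ∈ L := fun x hx g hg => by
    simpa using mul_mem (hN (hcomm x hx g (hL hg))) hg
  refine fun x hx g => ⟨h x hx g, fun hg => ?_⟩
  simpa [mul_assoc] using h x⁻¹ (inv_mem hx) _ hg

omit [Fintype G] in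
theorem exists_card_eq_mul_prime (hr : r.Prime) (hN : N ≤ M) (hM : Normalizes M N) (hne : N ≠ M)
    (hpow : ∀ m ∈ M, m ^ r ∈ N) : ∃ L, N ≤ L ∧ L ≤ M ∧ Nat.card L = Nat.card N * r := by
  have := normal_subgroupOf hM
  obtain ⟨x, hx, hxN⟩ := SetLike.exists_of_lt (lt_of_le_of_ne hN hne)
  let f := QuotientGroup.mk' (N.subgroupOf M)
  let L' := (Subgroup.zpowers (f ⟨x, hx⟩)).comap f
  have hNL : N.subgroupOf M ≤ L' := fun g hg => by
    have : f g = 1 := (QuotientGroup.eq_one_iff g).2 hg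
    rw [Subgroup.mem_comap, this]
    exact one_mem _
  refine ⟨L'.map M.subtype, fun g hg => ⟨⟨g, hN hg⟩, hNL hg, rfl⟩, Subgroup.map_subtype_le _, ?_⟩
  rw [← Nat.card_congr (L'.equivMapOfInjective M.subtype M.subtype_injective).toEquiv,
    ← card_mul_relIndex hNL, Nat.card_congr (Subgroup.subgroupOfEquivOfLe hN).toEquiv]
  congr 1
  have hker := Subgroup.relIndex_ker (K := L') f
  rw [QuotientGroup.ker_mk'] at hker
  rw [hker, Subgroup.map_comap_eq_self_of_surjective (QuotientGroup.mk'_surjective _),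
    Nat.card_zpowers]
  have : Fact r.Prime := ⟨hr⟩
  refine orderOf_eq_prime ?_ fun h => hxN ((QuotientGroup.eq_one_iff (⟨x, hx⟩ : M)).1 h)
  rw [← map_pow]
  exact (QuotientGroup.eq_one_iff _).2 (hpow x hx)

theorem exists_linear_character (hr : r.Prime) (hN : N ≤ L) (hL : Normalizes L N)
    (hcard : Nat.card L = Nat.card N * r) :
    ∃ l : L →* ℂˣ, (∀ g : L, l g = 1 ↔ (g : G) ∈ N) ∧ l ^ r = 1 := by
  have := normal_subgroupOf hL
  have : Fact r.Prime := ⟨hr⟩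
  have hQ : Nat.card (L ⧸ N.subgroupOf L) = r :=
    Nat.eq_of_mul_eq_mul_left Nat.card_pos ((card_mul_relIndex hN).trans hcard)
  have := isCyclic_of_prime_card hQ
  let := IsCyclic.commGroup (α := L ⧸ N.subgroupOf L)
  have : Nontrivial (L ⧸ N.subgroupOf L) :=
    Finite.one_lt_card_iff_nontrivial.1 (by rw [hQ]; exact hr.one_lt)
  have : NeZero (Monoid.exponent (L ⧸ N.subgroupOf L)) :=
    ⟨Monoid.exponent_ne_zero_of_finite⟩
  obtain ⟨q, hq⟩ := exists_ne (1 : L ⧸ N.subgroupOf L)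
  obtain ⟨l, hl⟩ := CommGroup.exists_apply_ne_one_of_hasEnoughRootsOfUnity
    (L ⧸ N.subgroupOf L) ℂ hq
  have hinj : Function.Injective l := by
    rw [← MonoidHom.ker_eq_bot_iff]
    refine (Subgroup.eq_bot_or_eq_top_of_prime_card (hp := by rwa [hQ]) l.ker).resolve_right
      fun h => hl ?_
    rw [← MonoidHom.mem_ker, h]
    trivial
  refine ⟨l.comp (QuotientGroup.mk' _), fun g => ?_, ?_⟩
  · rw [MonoidHom.comp_apply, ← map_one l, hinj.eq_iff, QuotientGroup.mk'_apply,
      QuotientGroup.eq_one_iff]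
    rfl
  · ext g
    have : (QuotientGroup.mk' (N.subgroupOf L) g) ^ r = 1 := hQ ▸ pow_card_eq_one'
    rw [MonoidHom.pow_apply, MonoidHom.comp_apply, ← map_pow, this, map_one]
    rfl

/-- The product of a function with a linear character of `L`. -/
def twist (l : L →* ℂˣ) (χ : G → ℂ) : G → ℂ := fun g => if h : g ∈ L then l ⟨g, h⟩ * χ g else 0

omit [Fintype G] in
theorem twist_apply (l : L →* ℂˣ) (χ : G → ℂ) (g : L) : twist l χ g = l g * χ g := by
  simp [twist]

/-- The product of a representation with a linear character. -/
def twistRep {n : ℕ} (l : L →* ℂˣ) (ρ : L →* Matrix (Fin n) (Fin n) ℂ) :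
    L →* Matrix (Fin n) (Fin n) ℂ where
  toFun g := (l g : ℂ) • ρ g
  map_one' := by simp
  map_mul' g h := by simp [smul_smul, mul_comm]

omit [Fintype G] in
theorem trace_twistRep {n : ℕ} (l : L →* ℂˣ) (ρ : L →* Matrix (Fin n) (Fin n) ℂ)
    (hρ : ∀ g : L, χ g = (ρ g).trace) (g : L) : twist l χ g = (twistRep l ρ g).trace := by
  rw [twist_apply, hρ]
  exact (Matrix.trace_smul (l g : ℂ) (ρ g)).symm

omit [Fintype G] in
theorem det_twistRep {n : ℕ} (l : L →* ℂˣ) (ρ : L →* Matrix (Fin n) (Fin n) ℂ) (g : L) :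
    (twistRep l ρ g).det = (l g : ℂ) ^ n * (ρ g).det := by
  refine (Matrix.det_smul _ _).trans ?_
  rw [Fintype.card_fin]

theorem twist_mem_irr (l : L →* ℂˣ) (hχ : χ ∈ irr L) : twist l χ ∈ irr L := by
  obtain ⟨n, ρ, hρ⟩ := isMatrixOn_of_mem_irr hχ
  refine mem_irr_of_subForm_eq_one (fun g hg => dif_neg hg)
    ⟨n, twistRep l ρ, trace_twistRep l ρ hρ⟩ ?_
  rw [← subForm_self hχ, subForm, subForm, charForm, charForm]
  congr 1
  refine Finset.sum_congr rfl fun g _ => ?_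
  rw [twist_apply, twist_apply, map_inv, mul_mul_mul_comm, Units.val_inv_eq_inv_val,
    mul_inv_cancel₀ (Units.ne_zero _), one_mul]

/-- All characters over an invariant character of a subgroup of prime index are extensions, and
they differ by linear characters. -/
theorem mult_eq_one_and_exists_twist (hr : r.Prime) (hN : N ≤ L) (hL : Normalizes L N)
    (hcard : Nat.card L = Nat.card N * r) (hθ : θ ∈ irr N) (hinv : ∀ x ∈ L, conjFun x θ = θ)
    (l : L →* ℂˣ) (hl : ∀ g : L, l g = 1 ↔ (g : G) ∈ N) (hlr : l ^ r = 1) (hψ : ψ ∈ irr L)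
    (h : mult N ψ θ ≠ 0) :
    mult N ψ θ = 1 ∧ ∀ χ ∈ irr L, mult N χ θ ≠ 0 → ∃ j : ℕ, χ = twist (l ^ j) ψ := by
  have hsum : ∑ χ ∈ irr L, mult N χ θ ^ 2 = r := by
    have := sum_mult_sq_of_invariant hN hL hθ hinv
    rw [hcard] at this
    exact Nat.eq_of_mul_eq_mul_left Nat.card_pos this
  have hψN : ∀ g ∈ N, ψ g = mult N ψ θ * θ g := fun g hg =>
    apply_eq_mult_mul hN hL hθ hinv hψ h hg
  have hvan : ¬ ∀ g, g ∉ N → ψ g = 0 := fun hv => by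
    have h1 := IsSupportedOn.card_mul_subForm (K := N) hv hN ψ
    rw [subForm_self hψ, mul_one, hcard, subForm_congr hψN hψN, subForm_smul_left, subForm_comm,
      subForm_smul_left, subForm_self hθ, mul_one] at h1
    have h2 : Nat.card N * r = Nat.card N * (mult N ψ θ * mult N ψ θ) := by exact_mod_cast h1
    have h3 := Nat.eq_of_mul_eq_mul_left Nat.card_pos h2
    exact hr.prime.irreducible.not_isSquare ⟨_, h3⟩
  push Not at hvan
  obtain ⟨x, hxN, hx0⟩ := hvan
  have hxL : x ∈ L := by
    by_contra hxL
    exact hx0 ((mem_irr.1 hψ).1 x hxL)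
  have : Fact r.Prime := ⟨hr⟩
  have hord : orderOf (l ⟨x, hxL⟩) = r := orderOf_eq_prime
    (by rw [← MonoidHom.pow_apply, hlr, MonoidHom.one_apply]) fun h => hxN ((hl _).1 h)
  have hinj : Set.InjOn (fun j => twist (l ^ j) ψ) (Finset.range r) := fun i hi j hj hij => by
    have := congrFun hij x
    simp only [twist, hxL, dite_true] at this
    have := mul_right_cancel₀ hx0 this
    rw [Units.val_inj, MonoidHom.pow_apply, MonoidHom.pow_apply] at this
    exact pow_injOn_Iio_orderOf (by simpa [hord] using hi) (by simpa [hord] using hj) this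
  set I := (Finset.range r).image fun j => twist (l ^ j) ψ with hI
  have hIirr : I ⊆ irr L := fun χ hχ => by
    obtain ⟨j, -, rfl⟩ := Finset.mem_image.1 hχ
    exact twist_mem_irr _ hψ
  have hImult : ∀ χ ∈ I, mult N χ θ = mult N ψ θ := fun χ hχ => by
    obtain ⟨j, -, rfl⟩ := Finset.mem_image.1 hχ
    refine mult_congr (fun g hg => ?_) fun _ _ => rfl
    have := twist_apply (l ^ j) ψ ⟨g, hN hg⟩
    rwa [MonoidHom.pow_apply, (hl _).2 hg, one_pow, Units.val_one, one_mul] at this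
  have hIcard : I.card = r := by rw [hI, Finset.card_image_of_injOn hinj, Finset.card_range]
  have hIsum : ∑ χ ∈ I, mult N χ θ ^ 2 = r * mult N ψ θ ^ 2 := by
    rw [Finset.sum_congr rfl fun χ hχ => by rw [hImult χ hχ], Finset.sum_const, hIcard, smul_eq_mul]
  have hsplit := Finset.sum_sdiff (f := fun χ => mult N χ θ ^ 2) hIirr
  rw [hIsum, hsum] at hsplit
  have hone : mult N ψ θ = 1 := by
    have h1 : r * mult N ψ θ ^ 2 ≤ r * 1 := by omega
    have h2 := Nat.le_of_mul_le_mul_left h1 hr.pos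
    have h3 := Nat.one_le_iff_ne_zero.2 h
    nlinarith
  refine ⟨hone, fun χ hχ hχθ => ?_⟩
  by_contra! hcon
  rw [hone, one_pow, mul_one, Nat.add_eq_right, Finset.sum_eq_zero_iff] at hsplit
  refine hχθ (pow_eq_zero_iff two_ne_zero |>.1 (hsplit χ (Finset.mem_sdiff.2 ⟨hχ, fun hm => ?_⟩)))
  obtain ⟨j, -, hj⟩ := Finset.mem_image.1 hm
  exact hcon j hj.symm

end CoprimeStep

section CoprimeExtension

variable {G : Type} [Group G] [Fintype G] {L M N P : Subgroup G} {χ θ ψ : G → ℂ} {p r : ℕ}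

theorem det_eq_of_trace_eq {n n' : ℕ} (ρ : L →* Matrix (Fin n) (Fin n) ℂ)
    (σ : L →* Matrix (Fin n') (Fin n') ℂ) (h : ∀ g, (ρ g).trace = (σ g).trace) (g : L) :
    (ρ g).det = (σ g).det := by
  have := det_inclusion_eq_pow ρ σ le_rfl (e := 1) (fun g => (h g).trans (by simp)) g
  exact this.trans (pow_one _)

theorem apply_one_eq_prime_pow_of_restrict [Fact p.Prime] (hP : IsPGroup p P) (h : IsMatrixOn P θ)
    (h1 : subForm P θ θ = 1) : ∃ c : ℕ, θ 1 = (p ^ c : ℕ) := by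
  have hirr : (fun g => if g ∈ P then θ g else 0) ∈ irr P := by
    refine mem_irr_of_subForm_eq_one (fun g hg => if_neg hg) ?_ ?_
    · obtain ⟨n, ρ, hρ⟩ := h
      exact ⟨n, ρ, fun g => (if_pos g.2).trans (hρ g)⟩
    · rw [← h1]
      exact subForm_congr (fun g hg => if_pos hg) fun g hg => if_pos hg
  obtain ⟨d, hd, -, hdvd⟩ := exists_degree hirr
  obtain ⟨k, hk⟩ := hP.exists_card_eq
  rw [hk, Nat.dvd_prime_pow Fact.out] at hdvd
  obtain ⟨c, -, rfl⟩ := hdvd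
  exact ⟨c, by rw [← hd]; exact (if_pos (one_mem P)).symm⟩

theorem IsGood.apply_one_eq (hp : p.Prime) (hθ : IsGood p N θ) : ∃ c : ℕ, θ 1 = (p ^ c : ℕ) := by
  have : Fact p.Prime := ⟨hp⟩
  obtain ⟨P, hPN, hP, h1⟩ := hθ.exists_restrict
  exact apply_one_eq_prime_pow_of_restrict hP ((isMatrixOn_of_mem_irr hθ.mem).mono hPN) h1

theorem IsGood.exists_extension_hasPrimePowerDet (hp : p.Prime) (hr : r.Prime) (hpr : p ≠ r)
    (hN : N ≤ L) (hL : Normalizes L N) (hcard : Nat.card L = Nat.card N * r) (hθ : IsGood p N θ)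
    (hinv : ∀ x ∈ L, conjFun x θ = θ) :
    ∃ ψ ∈ irr L, (∀ g ∈ N, ψ g = θ g) ∧ HasPrimePowerDet p L ψ := by
  obtain ⟨l, hl, hlr⟩ := exists_linear_character hr hN hL hcard
  obtain ⟨χ, hχ, hχθ⟩ := exists_mult_ne_zero hN hθ.mem
  have hone := (mult_eq_one_and_exists_twist hr hN hL hcard hθ.mem hinv l hl hlr hχ hχθ).1
  have hχN : ∀ g ∈ N, χ g = θ g := fun g hg => by
    rw [apply_eq_mult_mul hN hL hθ.mem hinv hχ hχθ hg, hone, Nat.cast_one, one_mul]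
  obtain ⟨c, hc⟩ := hθ.apply_one_eq hp
  obtain ⟨n, ρ, hρ⟩ := isMatrixOn_of_mem_irr hχ
  have hn : n = p ^ c := by
    have : χ 1 = _ := hρ 1
    rw [map_one, Matrix.trace_one, Fintype.card_fin, hχN 1 (one_mem N),
      hc] at this
    exact_mod_cast this.symm
  obtain ⟨n', σ, hσ, b, hb⟩ := hθ.hasPrimePowerDet
  let δ : L →* ℂˣ := (Matrix.detMonoidHom.comp ρ).toHomUnits
  have hδ : ∀ g, (δ g : ℂ) = (ρ g).det := fun g => rfl
  have hδN : ∀ g : L, (g : G) ∈ N → δ g ^ p ^ b = 1 := fun g hg => by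
    have := det_inclusion_eq_pow ρ σ hN (e := 1) (fun g => by
      rw [← hρ, ← hσ, Nat.cast_one, one_mul]
      exact hχN g g.2) ⟨g, hg⟩
    ext
    rw [Units.val_pow_eq_pow_val, hδ, Units.val_one, ← hb ⟨g, hg⟩, ← pow_one (σ _).det, ← this]
    rfl
  have hδr : ∀ g : L, (δ g ^ p ^ b) ^ r = 1 := fun g => by
    rw [← pow_mul, mul_comm, pow_mul, ← map_pow]
    refine hδN _ ((hl _).1 ?_)
    rw [map_pow, ← MonoidHom.pow_apply, hlr, MonoidHom.one_apply]
  obtain ⟨s, k, hsk⟩ : ∃ s k : ℕ, s * (n * p ^ b) + 1 = r * k := by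
    have hco : (n * p ^ b).Coprime r := by
      rw [hn, ← pow_add]
      exact Nat.Coprime.pow_left _ ((Nat.coprime_primes hp hr).2 hpr)
    obtain ⟨m, -, hm⟩ := Nat.exists_mul_mod_eq_one_of_coprime hco hr.one_lt
    have h1 := Nat.div_add_mod (n * p ^ b * m) r
    rw [hm] at h1
    obtain ⟨r', rfl⟩ := Nat.exists_eq_add_of_le' hr.one_lt.le
    set t := n * p ^ b * m / (r' + 1)
    refine ⟨m * r', t * r' + 1, ?_⟩
    calc m * r' * (n * p ^ b) + 1 = n * p ^ b * m * r' + 1 := by ring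
      _ = (r' + 1) * (t * r' + 1) := by rw [← h1]; ring
  have hμ := trace_twistRep ((δ ^ p ^ b) ^ s) ρ hρ
  refine ⟨_, twist_mem_irr ((δ ^ p ^ b) ^ s) hχ, fun g hg => ?_, n, _, hμ, b, fun g => ?_⟩
  · have := twist_apply ((δ ^ p ^ b) ^ s) χ ⟨g, hN hg⟩
    rwa [MonoidHom.pow_apply, MonoidHom.pow_apply, hδN _ hg, one_pow, Units.val_one, one_mul,
      hχN g hg] at this
  · rw [det_twistRep, ← hδ, ← Units.val_pow_eq_pow_val, ← Units.val_mul, ← Units.val_pow_eq_pow_val,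
      Units.val_eq_one, MonoidHom.pow_apply, MonoidHom.pow_apply, mul_pow, ← pow_mul _ s, ← pow_mul,
      ← pow_succ, mul_assoc, hsk, pow_mul, hδr, one_pow]

theorem eq_of_hasPrimePowerDet (hp : p.Prime) (hr : r.Prime) (hpr : p ≠ r)
    (hN : N ≤ L) (hL : Normalizes L N) (hcard : Nat.card L = Nat.card N * r) (hθ : IsGood p N θ)
    (hinv : ∀ x ∈ L, conjFun x θ = θ) (hχ : χ ∈ irr L) (hψ : ψ ∈ irr L)
    (hχθ : mult N χ θ ≠ 0) (hψθ : mult N ψ θ ≠ 0) (hχd : HasPrimePowerDet p L χ)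
    (hψd : HasPrimePowerDet p L ψ) : χ = ψ := by
  obtain ⟨l, hl, hlr⟩ := exists_linear_character hr hN hL hcard
  obtain ⟨hone, hj⟩ := mult_eq_one_and_exists_twist hr hN hL hcard hθ.mem hinv l hl hlr hψ hψθ
  obtain ⟨j, rfl⟩ := hj χ hχ hχθ
  obtain ⟨c, hc⟩ := hθ.apply_one_eq hp
  obtain ⟨n, ρ, hρ, b, hb⟩ := hψd
  obtain ⟨n', ρ', hρ', b', hb'⟩ := hχd
  have hn : n = p ^ c := by
    have : ψ 1 = _ := hρ 1
    rw [map_one, Matrix.trace_one, Fintype.card_fin,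
      apply_eq_mult_mul hN hL hθ.mem hinv hψ hψθ (one_mem N), hone, Nat.cast_one, one_mul, hc] at this
    exact_mod_cast this.symm
  refine irr_ext hχ hψ fun g hg => ?_
  have h1 := det_eq_of_trace_eq (twistRep (l ^ j) ρ) ρ' (fun g =>
    (trace_twistRep (l ^ j) ρ hρ g).symm.trans (hρ' g)) ⟨g, hg⟩
  rw [det_twistRep] at h1
  have h2 : ((l ^ j) ⟨g, hg⟩ : ℂˣ) ^ (p ^ (c + b + b')) = 1 := by
    have h3 := congrArg (· ^ p ^ (b + b')) h1
    rw [mul_pow, pow_add p b b', pow_mul (ρ _).det, hb, one_pow, mul_one, mul_comm (p ^ b),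
      pow_mul (ρ' _).det, hb', one_pow, ← pow_mul, hn, ← pow_add, ← pow_add] at h3
    ext
    rw [Units.val_pow_eq_pow_val, Units.val_one, ← h3]
    congr 2
    ring
  have h4 : ((l ^ j) ⟨g, hg⟩ : ℂˣ) ^ r = 1 := by
    rw [MonoidHom.pow_apply, ← pow_mul, mul_comm, pow_mul, ← MonoidHom.pow_apply, hlr,
      MonoidHom.one_apply, one_pow]
  have h5 := pow_gcd_eq_one.2 ⟨h2, h4⟩
  rw [Nat.Coprime.pow_left _ ((Nat.coprime_primes hp hr).2 hpr), pow_one] at h5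
  rw [twist_apply (l ^ j) ψ ⟨g, hg⟩, h5, Units.val_one, one_mul]

/-- Canonical extensions along prime index different from `p`. -/
theorem IsGood.exists_extension_of_card_eq (hp : p.Prime) (hr : r.Prime) (hpr : p ≠ r)
    (hN : N ≤ L) (hL : Normalizes L N) (hcard : Nat.card L = Nat.card N * r) (hθ : IsGood p N θ)
    (hinv : ∀ x ∈ L, conjFun x θ = θ) :
    ∃ ψ, IsGood p L ψ ∧ (∀ g ∈ N, ψ g = θ g) ∧
      ∀ x, (∀ g, g ∈ L ↔ x * g * x⁻¹ ∈ L) → (∀ g, g ∈ N ↔ x * g * x⁻¹ ∈ N) →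
        conjFun x θ = θ → conjFun x ψ = ψ := by
  obtain ⟨ψ, hψ, hψN, hdet⟩ :=
    hθ.exists_extension_hasPrimePowerDet hp hr hpr hN hL hcard hinv
  have hmult : ∀ χ : G → ℂ, (∀ g ∈ N, χ g = θ g) → mult N χ θ ≠ 0 := fun χ hχ => by
    rw [mult_congr hχ fun _ _ => rfl, mult_eq (n := 1) (by rw [subForm_self hθ.mem, Nat.cast_one])]
    exact one_ne_zero
  have huniq : ∀ χ ∈ irr L, (∀ g ∈ N, χ g = θ g) → HasPrimePowerDet p L χ → χ = ψ :=
    fun χ hχ hχN hd => eq_of_hasPrimePowerDet hp hr hpr hN hL hcard hθ hinv hχ hψ (hmult χ hχN)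
      (hmult ψ hψN) hd hdet
  obtain ⟨n, ρ, hρ, b, hb⟩ := hdet
  refine ⟨ψ, ⟨hψ, fun τ hτ => ?_, ⟨n, ρ, hρ, b, hb⟩, ?_⟩, hψN, fun x hxL hxN hxθ => ?_⟩
  · refine huniq _ (map_mem_irr τ hψ) (fun g hg => ?_)
      ⟨n, τ.mapMatrix.toMonoidHom.comp ρ, fun g => ?_, b, fun g => ?_⟩
    · refine (congrArg τ (hψN g hg)).trans ?_
      exact congrFun (hθ.isFixedOver τ hτ) g
    · refine (congrArg τ (hρ g)).trans ?_
      exact AddMonoidHom.map_trace τ.toAddMonoidHom (ρ g)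
    · have : ((τ.mapMatrix.toMonoidHom.comp ρ) g).det = τ (ρ g).det := (τ.map_det (ρ g)).symm
      rw [this, ← map_pow, hb, map_one]
  · obtain ⟨P, hPN, hP, h1⟩ := hθ.exists_restrict
    refine ⟨P, hPN.trans hN, hP, ?_⟩
    rw [← h1]
    exact subForm_congr (fun g hg => hψN g (hPN hg)) fun g hg => hψN g (hPN hg)
  · let e : L →* L :=
      { toFun := fun g => ⟨x * g * x⁻¹, (hxL g).1 g.2⟩
        map_one' := by ext; simp
        map_mul' := fun g h => by ext; simp }
    refine huniq _ (conjFun_mem_irr hψ hxL) (fun g hg => ?_)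
      ⟨n, ρ.comp e, fun g => hρ (e g), b, fun g => hb (e g)⟩
    rw [← hxθ]
    exact hψN _ ((hxN g).1 hg)

end CoprimeExtension

section Solvable

theorem exists_normal_commute_of_isSolvable (Q : Type) [Group Q] [Finite Q] [Group.IsSolvable Q]
    [Nontrivial Q] : ∃ (A : Subgroup Q) (r : ℕ), A.Normal ∧ A ≠ ⊥ ∧ r.Prime ∧
      (∀ x ∈ A, ∀ y ∈ A, x * y = y * x) ∧ ∀ x ∈ A, x ^ r = 1 := by
  have hex := Group.IsSolvable.solvable (G := Q)
  obtain ⟨n, hn⟩ : ∃ n, Nat.find hex = n + 1 := Nat.exists_eq_succ_of_ne_zero fun h0 => by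
    have := Nat.find_spec hex
    rw [h0, derivedSeries_zero] at this
    exact top_ne_bot this
  set D := derivedSeries Q n with hD
  have hDbot : D ≠ ⊥ := Nat.find_min hex (by omega)
  have hDcomm : ∀ x ∈ D, ∀ y ∈ D, x * y = y * x := fun x hx y hy => by
    have h := Nat.find_spec hex
    rw [hn, derivedSeries_succ] at h
    have := Subgroup.commutator_mem_commutator hx hy
    rw [h, Subgroup.mem_bot] at this
    exact commutatorElement_eq_one_iff_mul_comm.1 this
  have hDn : D.Normal := derivedSeries_normal Q n
  have hcard : Nat.card D ≠ 1 := fun h => hDbot (Subgroup.card_eq_one.1 h)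
  have hr := Nat.minFac_prime hcard
  have : Fact (Nat.card D).minFac.Prime := ⟨hr⟩
  obtain ⟨d, hd⟩ := exists_prime_orderOf_dvd_card' (G := D) _ (Nat.minFac_dvd _)
  refine ⟨{ carrier := {x | x ∈ D ∧ x ^ (Nat.card D).minFac = 1}
            one_mem' := ⟨one_mem _, one_pow _⟩
            mul_mem' := fun {x y} hx hy => ⟨mul_mem hx.1 hy.1, by
              rw [Commute.mul_pow (hDcomm x hx.1 y hy.1), hx.2, hy.2, one_mul]⟩
            inv_mem' := fun {x} hx => ⟨inv_mem hx.1, by rw [inv_pow, hx.2, inv_one]⟩ },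
    _, ⟨fun x hx g => ⟨hDn.conj_mem x hx.1 g, by rw [conj_pow, hx.2, mul_one, mul_inv_cancel]⟩⟩,
    fun h => ?_, hr, fun x hx y hy => hDcomm x hx.1 y hy.1, fun x hx => hx.2⟩
  have hdm : (d : Q) ∈ (⊥ : Subgroup Q) := by
    rw [← h]
    exact ⟨d.2, by rw [← hd, ← Subgroup.orderOf_coe, pow_orderOf_eq_one]⟩
  have hd1 : d = 1 := Subtype.ext (Subgroup.mem_bot.1 hdm)
  rw [hd1, orderOf_one] at hd
  exact hr.ne_one hd.symm

variable {G : Type} [Group G] [Fintype G] {L M N T : Subgroup G} {χ θ ψ : G → ℂ} {p r : ℕ}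

omit [Fintype G] in
theorem exists_chief_step [Finite G] [Group.IsSolvable G] (hN : N ≤ T) (hT : Normalizes T N)
    (hne : N ≠ T) : ∃ (M : Subgroup G) (r : ℕ), N ≤ M ∧ N ≠ M ∧ M ≤ T ∧ Normalizes T M ∧ r.Prime ∧
      (∀ x ∈ M, ∀ y ∈ M, x * y * x⁻¹ * y⁻¹ ∈ N) ∧ ∀ x ∈ M, x ^ r ∈ N := by
  have := normal_subgroupOf hT
  let f := QuotientGroup.mk' (N.subgroupOf T)
  have hf : ∀ x, f x = 1 ↔ (x : G) ∈ N := fun x => QuotientGroup.eq_one_iff x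
  obtain ⟨x, hxT, hxN⟩ := SetLike.exists_of_lt (lt_of_le_of_ne hN hne)
  have : Nontrivial (T ⧸ N.subgroupOf T) := ⟨f ⟨x, hxT⟩, 1, fun h => hxN ((hf _).1 h)⟩
  obtain ⟨A, r, hA, hAbot, hr, hcomm, hpow⟩ :=
    exists_normal_commute_of_isSolvable (T ⧸ N.subgroupOf T)
  have hmem : ∀ g : G, g ∈ (A.comap f).map T.subtype ↔ ∃ h : g ∈ T, f ⟨g, h⟩ ∈ A := fun g => by
    constructor
    · rintro ⟨⟨y, hy⟩, hyA, rfl⟩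
      exact ⟨hy, hyA⟩
    · rintro ⟨h, hA⟩
      exact ⟨⟨g, h⟩, hA, rfl⟩
  refine ⟨(A.comap f).map T.subtype, r, fun g hg => ?_, fun h => ?_, Subgroup.map_subtype_le _,
    fun x hx g => ?_, hr, fun x hx y hy => ?_, fun x hx => ?_⟩
  · rw [hmem]
    exact ⟨hN hg, by rw [(hf _).2 hg]; exact one_mem _⟩
  · refine hAbot ((Subgroup.eq_bot_iff_forall _).2 fun a ha => ?_)
    obtain ⟨⟨y, hy⟩, rfl⟩ := QuotientGroup.mk'_surjective _ a
    rw [hf, h, hmem]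
    exact ⟨hy, ha⟩
  · rw [hmem, hmem]
    constructor
    · rintro ⟨h, hg⟩
      exact ⟨mul_mem (mul_mem hx h) (inv_mem hx), hA.conj_mem _ hg (f ⟨x, hx⟩)⟩
    · rintro ⟨h, hg⟩
      have hgT : g ∈ T := by simpa [mul_assoc] using mul_mem (mul_mem (inv_mem hx) h) hx
      refine ⟨hgT, ?_⟩
      have := hA.conj_mem _ hg (f ⟨x, hx⟩⁻¹)
      rw [← map_inv, ← map_mul, ← map_mul] at this
      convert this using 2
      ext
      simp [mul_assoc]
  · rw [hmem] at hx hy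
    obtain ⟨hxT, hx⟩ := hx
    obtain ⟨hyT, hy⟩ := hy
    have : f (⟨x, hxT⟩ * ⟨y, hyT⟩ * ⟨x, hxT⟩⁻¹ * ⟨y, hyT⟩⁻¹) = 1 := by
      rw [map_mul, map_mul, map_mul, hcomm _ hx _ hy, map_inv, map_inv, mul_inv_cancel_right,
        mul_inv_cancel]
    exact (hf _).1 this
  · rw [hmem] at hx
    obtain ⟨hxT, hx⟩ := hx
    have : f (⟨x, hxT⟩ ^ r) = 1 := by rw [map_pow, hpow _ hx]
    exact (hf _).1 this

theorem IsGood.exists_extension_of_pow_mem (hp : p.Prime) (hr : r.Prime) (hpr : p ≠ r)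
    (hN : N ≤ M) (hM : Normalizes M N) (hcomm : ∀ x ∈ M, ∀ y ∈ M, x * y * x⁻¹ * y⁻¹ ∈ N)
    (hpow : ∀ x ∈ M, x ^ r ∈ N) (hθ : IsGood p N θ) (hinv : ∀ x ∈ M, conjFun x θ = θ) :
    ∃ ψ, IsGood p M ψ ∧ ∀ g ∈ N, ψ g = θ g := by
  induction hn : Nat.card M - Nat.card N using Nat.strong_induction_on generalizing N θ with
  | _ n ih =>
  by_cases hne : N = M
  · subst hne
    exact ⟨θ, hθ, fun _ _ => rfl⟩
  obtain ⟨L, hNL, hLM, hcard⟩ := exists_card_eq_mul_prime hr hN hM hne hpow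
  have hML := normalizes_of_commutator_mem hNL hLM hcomm
  obtain ⟨ψ, hψ, hψN, hψinv⟩ := hθ.exists_extension_of_card_eq hp hr hpr hNL
    (fun x hx => hM x (hLM hx)) hcard fun x hx => hinv x (hLM hx)
  have hlt : Nat.card N < Nat.card L := by
    rw [hcard]
    exact lt_mul_of_one_lt_right Nat.card_pos hr.one_lt
  have hle := Subgroup.card_le_of_le hLM
  obtain ⟨φ, hφ, hφL⟩ := ih _ (by omega) hLM hML (fun x hx y hy => hNL (hcomm x hx y hy))
    (fun x hx => hNL (hpow x hx)) hψ (fun x hx => hψinv x (hML x hx) (hM x hx) (hinv x hx)) rfl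
  exact ⟨φ, hφ, fun g hg => (hφL g (hNL hg)).trans (hψN g hg)⟩

theorem IsGood.exists_over_of_commutator_mem (hp : p.Prime) (hr : r.Prime)
    (hN : N ≤ M) (hM : Normalizes M N) (hcomm : ∀ x ∈ M, ∀ y ∈ M, x * y * x⁻¹ * y⁻¹ ∈ N)
    (hpow : ∀ x ∈ M, x ^ r ∈ N) (hθ : IsGood p N θ) (hinv : ∀ x ∈ M, conjFun x θ = θ) :
    ∃ ψ, IsGood p M ψ ∧ mult N ψ θ ≠ 0 := by
  by_cases hpr : p = r
  · subst hpr
    obtain ⟨ψ, hψ, h⟩ := exists_mult_ne_zero hN hθ.mem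
    have := normal_subgroupOf hM
    have : Fact p.Prime := ⟨hp⟩
    have hQ : IsPGroup p (M ⧸ N.subgroupOf M) := fun q => by
      obtain ⟨x, rfl⟩ := QuotientGroup.mk'_surjective _ q
      refine ⟨1, ?_⟩
      rw [pow_one, ← map_pow]
      exact (QuotientGroup.eq_one_iff _).2 (hpow x x.2)
    obtain ⟨s, hs⟩ := hQ.exists_card_eq
    refine ⟨ψ, hθ.of_pow_mem hp hN hM hinv hpow (s := s) ?_ hψ h, h⟩
    rw [← card_mul_relIndex hN, ← hs]
    rfl
  · obtain ⟨ψ, hψ, hψN⟩ := hθ.exists_extension_of_pow_mem hp hr hpr hN hM hcomm hpow hinv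
    refine ⟨ψ, hψ, ?_⟩
    rw [mult_congr hψN fun _ _ => rfl, mult_eq (n := 1) (by rw [subForm_self hθ.mem, Nat.cast_one])]
    exact one_ne_zero

omit [Fintype G] in
theorem conjFun_mul (x y : G) (a : G → ℂ) : conjFun (x * y) a = conjFun y (conjFun x a) := by
  ext g
  simp [conjFun, mul_assoc]

omit [Fintype G] in
theorem conjFun_one (a : G → ℂ) : conjFun 1 a = a := by
  ext g
  simp [conjFun]

theorem conjFun_eq_of_mem (hθ : θ ∈ irr N) {x : G} (hx : x ∈ N) : conjFun x θ = θ :=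
  funext fun g => by
    have h : g ∈ N ↔ x * g * x⁻¹ ∈ N := by
      refine ⟨fun hg => mul_mem (mul_mem hx hg) (inv_mem hx), fun hg => ?_⟩
      simpa [mul_assoc] using mul_mem (mul_mem (inv_mem hx) hg) hx
    by_cases hg : g ∈ N
    · exact (isMatrixOn_of_mem_irr hθ).isClassOn x hx g hg
    · rw [conjFun, (mem_irr.1 hθ).1 g hg, (mem_irr.1 hθ).1 _ fun h' => hg (h.2 h')]

/-- The stabilizer in `T` of a function under conjugation. -/
def stab (T : Subgroup G) (a : G → ℂ) : Subgroup G where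
  carrier := {x | x ∈ T ∧ conjFun x a = a}
  one_mem' := ⟨one_mem _, conjFun_one a⟩
  mul_mem' {x y} hx hy := ⟨mul_mem hx.1 hy.1, by rw [conjFun_mul, hx.2, hy.2]⟩
  inv_mem' {x} hx := ⟨inv_mem hx.1, by
    conv_lhs => rw [← hx.2]
    rw [← conjFun_mul, mul_inv_cancel, conjFun_one]⟩

/-- A good character of a normal subgroup of a solvable group lies under a character whose values
are fixed over `Qfield p`. -/
theorem IsGood.exists_isFixedOver [Group.IsSolvable G] (hp : p.Prime) (hN : N ≤ T)
    (hT : Normalizes T N) (hθ : IsGood p N θ) :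
    ∃ χ ∈ irr T, IsFixedOver p χ ∧ mult N χ θ ≠ 0 := by
  induction hn : Nat.card T - Nat.card N using Nat.strong_induction_on generalizing N T θ with
  | _ n ih =>
  have hST : stab T θ ≤ T := fun x hx => hx.1
  have hNS : N ≤ stab T θ := fun x hx => ⟨hN hx, conjFun_eq_of_mem hθ.mem hx⟩
  by_cases hS : stab T θ = T
  · have hinv : ∀ x ∈ T, conjFun x θ = θ := fun x hx => by
      rw [← hS] at hx
      exact hx.2
    by_cases hne : N = T
    · subst hne
      refine ⟨θ, hθ.mem, hθ.isFixedOver, ?_⟩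
      rw [mult_eq (n := 1) (by rw [subForm_self hθ.mem, Nat.cast_one])]
      exact one_ne_zero
    obtain ⟨M, r, hNM, hNM', hMT, hTM, hr, hcomm, hpow⟩ := exists_chief_step hN hT hne
    obtain ⟨ψ, hψ, hψθ⟩ := hθ.exists_over_of_commutator_mem hp hr hNM
      (fun x hx => hT x (hMT hx)) hcomm hpow fun x hx => hinv x (hMT hx)
    have hlt : Nat.card N < Nat.card M :=
      lt_of_le_of_ne (Subgroup.card_le_of_le hNM) fun h => hNM' (Subgroup.eq_of_le_of_card_ge hNM h.ge)
    have hle := Subgroup.card_le_of_le hMT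
    obtain ⟨χ, hχ, hfix, h⟩ := ih _ (by omega) hMT hTM hψ rfl
    exact ⟨χ, hχ, hfix, mult_trans_ne_zero hNM hMT hθ.mem hψ.mem hχ hψθ h⟩
  · have hlt : Nat.card (stab T θ) < Nat.card T :=
      lt_of_le_of_ne (Subgroup.card_le_of_le hST) fun h => hS (Subgroup.eq_of_le_of_card_ge hST h.ge)
    have hle := Subgroup.card_le_of_le hNS
    obtain ⟨ψ, hψ, hfix, hψθ⟩ := ih _ (by omega) hNS (fun x hx => hT x (hST hx)) hθ rfl
    obtain ⟨χ, hχ, h⟩ := exists_mult_ne_zero hST hψ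
    refine ⟨χ, hχ, fun τ hτ => ?_, mult_trans_ne_zero hNS hST hθ.mem hψ hχ hψθ h⟩
    refine eq_of_mult_stabilizer_ne_zero hNS hST hT hθ.mem
      (fun x hx => ⟨fun hfx => ⟨hx, hfx⟩, fun hfx => hfx.2⟩) hψ hψθ (map_mem_irr τ hχ) hχ ?_ h
    conv => rw [← hfix τ hτ]
    rw [mult_map τ ((isMatrixOn_of_mem_irr hχ).mono hST) (isMatrixOn_of_mem_irr hψ)]
    exact h

end Solvable

theorem normalizes_of_normal {G : Type} [Group G] (T A : Subgroup G) [hA : A.Normal] :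
    Normalizes T A :=
  fun x _ g => ⟨fun h => hA.conj_mem g h x, fun h => by
    simpa [mul_assoc] using hA.conj_mem _ h x⁻¹⟩

section Counting

variable {G : Type} [Group G] [Fintype G] {A H : Subgroup G} {χ θ : G → ℂ} {p : ℕ}

theorem isGood_of_pow_eq_one (hp : p.Prime) (hA : ∀ x ∈ A, x ^ p = 1) (hθ : θ ∈ irr A) :
    IsGood p A θ := by
  refine ⟨hθ, fun τ hτ => funext fun g => ?_, ?_, A, le_rfl, fun x => ⟨1, ?_⟩, subForm_self hθ⟩
  · by_cases hg : g ∈ A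
    · refine hτ _ (IsMatrixCharacter.mem_Qfield (isMatrixOn_of_mem_irr hθ) hp.pos (a := 1)
        (g := ⟨g, hg⟩) (Subtype.ext ?_))
      rw [pow_one]
      exact hA g hg
    · rw [(mem_irr.1 hθ).1 g hg, map_zero]
  · obtain ⟨n, ρ, hρ⟩ := isMatrixOn_of_mem_irr hθ
    refine ⟨n, ρ, hρ, 1, fun g => ?_⟩
    have hg : g ^ p = 1 := Subtype.ext (hA g g.2)
    rw [pow_one, ← Matrix.det_pow, ← map_pow, hg, map_one, Matrix.det_one]
  · rw [pow_one]
    exact Subtype.ext (hA x x.2)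

/-- The trivial character of a subgroup, extended by zero. -/
def trivialOn (A : Subgroup G) : G → ℂ := fun g => if g ∈ A then 1 else 0

theorem trivialOn_mem_irr (A : Subgroup G) : trivialOn A ∈ irr A := by
  refine mem_irr_of_subForm_eq_one (fun g hg => if_neg hg) ⟨1, 1, fun g => ?_⟩ ?_
  · simp [trivialOn]
  · have h1 : ∀ g ∈ A, trivialOn A g = (fun _ => (1 : ℂ)) g := fun g hg => if_pos hg
    rw [subForm_congr h1 h1]
    unfold subForm charForm
    simp

theorem card_le_card_irr (hA : ∀ x ∈ A, ∀ y ∈ A, x * y = y * x) : Nat.card A ≤ (irr A).card := by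
  let res : (G → ℂ) → A → ℂ := fun f g => f g
  have hspan : Submodule.span ℂ (((irr A).image res : Finset (A → ℂ)) : Set (A → ℂ)) = ⊤ := by
    rw [eq_top_iff]
    rintro f -
    let F : G → ℂ := fun g => if h : g ∈ A then f ⟨g, h⟩ else 0
    have hF : IsClassOn A F := fun x hx g hg => by rw [hA x hx g hg, mul_inv_cancel_right]
    have : f = ∑ χ ∈ irr A, subForm A F χ • res χ := by
      ext g
      have h1 : F g = f g := dif_pos g.2
      rw [← h1, hF.eq_sum g.2, Finset.sum_apply]
      rfl
    rw [this]
    exact Submodule.sum_mem _ fun χ hχ => Submodule.smul_mem _ _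
      (Submodule.subset_span (Finset.mem_coe.2 (Finset.mem_image_of_mem _ hχ)))
  have h1 := finrank_span_finset_le_card (R := ℂ) ((irr A).image res)
  rw [Set.finrank, hspan, finrank_top, Module.finrank_fintype_fun_eq_card,
    ← Nat.card_eq_fintype_card] at h1
  exact h1.trans Finset.card_image_le

theorem isIrreducibleCharacter_of_mem_irr_top (h : χ ∈ irr (⊤ : Subgroup G)) :
    IsIrreducibleCharacter G χ := by
  rw [isIrreducibleCharacter_iff]
  obtain ⟨n, ρ, hρ⟩ := isMatrixOn_of_mem_irr h
  refine ⟨⟨n, ρ.comp Subgroup.topEquiv.symm.toMonoidHom, fun g => hρ (Subgroup.topEquiv.symm g)⟩, ?_⟩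
  have h1 := card_mul_subForm ⊤ χ χ
  rw [subForm_self h, mul_one, Subgroup.card_top] at h1
  simp only [Subgroup.mem_top, if_true] at h1
  rw [charForm, ← h1, inv_mul_cancel₀ (Nat.cast_ne_zero.mpr Nat.card_pos.ne')]

theorem mem_QppValuedIrrChars_of_isFixedOver (hp : p.Prime) (h : χ ∈ irr (⊤ : Subgroup G))
    (hfix : IsFixedOver p χ) : χ ∈ QppValuedIrrChars G := by
  have hirr := isIrreducibleCharacter_of_mem_irr_top h
  refine ⟨hirr, p, hp, fun g => ?_⟩
  by_contra hg
  obtain ⟨τ, hτ, hne⟩ := exists_ringHom_ne (hirr.isMatrixCharacter.isIntegral g) hg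
  exact hne (congrFun (hfix τ hτ) g)

theorem QppValuedIrrChars_finite : (QppValuedIrrChars G).Finite :=
  setOf_isIrreducibleCharacter_finite.subset fun _ h => h.1

theorem charForm_comp {Q : Type} [Group Q] [Fintype Q] (f : G →* Q) (hf : Function.Surjective f)
    (a b : Q → ℂ) : charForm (fun g => a (f g)) (fun g => b (f g)) = charForm a b := by
  have key : ∀ F : Q → ℂ, ∑ g, F (f g) =
      (Finset.univ.filter fun g => f g = 1).card * ∑ q, F q := fun F => by
    rw [← Finset.sum_fiberwise_of_maps_to (g := f) (t := Finset.univ) fun _ _ => Finset.mem_univ _,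
      Finset.mul_sum]
    refine Finset.sum_congr rfl fun q _ => ?_
    rw [Finset.sum_congr rfl fun g hg => by rw [(Finset.mem_filter.1 hg).2], Finset.sum_const,
      nsmul_eq_mul, MonoidHom.card_fiber_eq_of_mem_range f (hf q) (hf 1)]
  have hcard := key fun _ => 1
  have h2 := key fun q => a q * b q⁻¹
  simp only [Finset.sum_const, Finset.card_univ, nsmul_eq_mul, mul_one,
    ← Nat.card_eq_fintype_card] at hcard
  have hG : (Nat.card G : ℂ) ≠ 0 := Nat.cast_ne_zero.mpr Nat.card_pos.ne'
  have hQ : (Nat.card Q : ℂ) ≠ 0 := Nat.cast_ne_zero.mpr Nat.card_pos.ne'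
  unfold charForm
  simp only [map_inv]
  rw [h2, inv_mul_eq_iff_eq_mul₀ hG, hcard, mul_assoc, mul_inv_cancel_left₀ hQ]

theorem IsIrreducibleCharacter.comp {Q : Type} [Group Q] [Fintype Q] {χ : Q → ℂ}
    (h : IsIrreducibleCharacter Q χ) (f : G →* Q) (hf : Function.Surjective f) :
    IsIrreducibleCharacter G fun g => χ (f g) := by
  rw [isIrreducibleCharacter_iff] at h ⊢
  obtain ⟨⟨n, ρ, hρ⟩, h1⟩ := h
  exact ⟨⟨n, ρ.comp f, fun g => hρ (f g)⟩, by rw [charForm_comp f hf, h1]⟩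

theorem eq_trivialOn_of_constant (hconst : ∀ g ∈ A, χ g = χ 1)
    (hθ : θ ∈ irr A) (h : mult A χ θ ≠ 0) : θ = trivialOn A := by
  by_contra hne
  apply h
  apply mult_eq
  rw [subForm_congr (a' := fun g => χ 1 * trivialOn A g) (b' := θ) (fun g hg => ?_) fun _ _ => rfl,
    subForm_smul_left, subForm_eq_ite (trivialOn_mem_irr A) hθ, if_neg (Ne.symm hne), mul_zero,
    Nat.cast_zero]
  rw [hconst g hg, trivialOn, if_pos hg, mul_one]

theorem card_filter_mult_ne_zero_le [A.Normal] (hχ : χ ∈ irr (⊤ : Subgroup G)) :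
    ((irr A).filter fun θ => mult A χ θ ≠ 0).card ≤ A.index := by
  obtain hempty | ⟨θ₀, h₀⟩ := ((irr A).filter fun θ => mult A χ θ ≠ 0).eq_empty_or_nonempty
  · rw [hempty, Finset.card_empty]
    exact Nat.zero_le _
  rw [Finset.mem_filter] at h₀
  have hsub : ((irr A).filter fun θ => mult A χ θ ≠ 0) ⊆
      (Finset.univ : Finset (G ⧸ A)).image fun q => conjFun q.out θ₀ := fun θ hθ => by
    rw [Finset.mem_filter] at hθ
    obtain ⟨x, rfl⟩ := exists_conjFun_eq (T := ⊤) le_top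
      (normalizes_of_normal ⊤ A) hχ hθ.1 h₀.1 hθ.2 h₀.2
    refine Finset.mem_image.2 ⟨(x : G), Finset.mem_univ _, ?_⟩
    obtain ⟨a, ha⟩ := QuotientGroup.mk_out_eq_mul A (x : G)
    have hmem : (x : G) * a * (x : G)⁻¹ ∈ A := Subgroup.Normal.conj_mem ‹_› _ a.2 _
    rw [ha, show (x : G) * a = (x * a * (x : G)⁻¹) * x by group, conjFun_mul,
      conjFun_eq_of_mem h₀.1 hmem]
  refine (Finset.card_le_card hsub).trans (Finset.card_image_le.trans ?_)
  rw [Finset.card_univ, ← Nat.card_eq_fintype_card]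
  rfl

end Counting

section Bound

variable {G : Type} [Group G] [Fintype G] {A : Subgroup G} {p : ℕ}

theorem exists_mem_QppValuedIrrChars_over [Group.IsSolvable G] [A.Normal] (hp : p.Prime)
    (hpow : ∀ x ∈ A, x ^ p = 1) {θ : G → ℂ} (hθ : θ ∈ irr A) :
    ∃ χ ∈ irr (⊤ : Subgroup G), χ ∈ QppValuedIrrChars G ∧ mult A χ θ ≠ 0 := by
  obtain ⟨χ, hχ, hfix, h⟩ := (isGood_of_pow_eq_one hp hpow hθ).exists_isFixedOver (T := ⊤) hp le_top
    (normalizes_of_normal ⊤ A)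
  exact ⟨χ, hχ, mem_QppValuedIrrChars_of_isFixedOver hp hχ hfix, h⟩

theorem card_le_ncard_mul_index [Group.IsSolvable G] [A.Normal] (hp : p.Prime)
    (hcomm : ∀ x ∈ A, ∀ y ∈ A, x * y = y * x) (hpow : ∀ x ∈ A, x ^ p = 1) :
    Nat.card A ≤ A.index * (QppValuedIrrChars G).ncard := by
  choose! c hc hcQ hcm using fun θ (hθ : θ ∈ irr A) => exists_mem_QppValuedIrrChars_over hp hpow hθ
  refine (card_le_card_irr hcomm).trans ((Finset.card_le_mul_card_image (f := c) _ A.index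
    fun χ hχ => ?_).trans (Nat.mul_le_mul_left _ ?_))
  · obtain ⟨θ, hθ, rfl⟩ := Finset.mem_image.1 hχ
    refine (Finset.card_le_card fun η hη => ?_).trans (card_filter_mult_ne_zero_le (hc θ hθ))
    rw [Finset.mem_filter] at hη ⊢
    exact ⟨hη.1, hη.2 ▸ hcm η hη.1⟩
  · rw [← Set.ncard_coe_finset]
    refine Set.ncard_le_ncard (fun χ hχ => ?_) QppValuedIrrChars_finite
    obtain ⟨θ, hθ, rfl⟩ := Finset.mem_image.1 (Finset.mem_coe.1 hχ)
    exact hcQ θ hθ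

theorem ncard_quotient_lt [Group.IsSolvable G] [A.Normal] (hp : p.Prime) (hne : A ≠ ⊥)
    (hcomm : ∀ x ∈ A, ∀ y ∈ A, x * y = y * x) (hpow : ∀ x ∈ A, x ^ p = 1) :
    (QppValuedIrrChars (G ⧸ A)).ncard < (QppValuedIrrChars G).ncard := by
  have hcard : 1 < (irr A).card :=
    lt_of_lt_of_le (A.one_lt_card_iff_ne_bot.2 hne) (card_le_card_irr hcomm)
  obtain ⟨θ, hθ, hθ1⟩ := Finset.exists_mem_ne hcard (trivialOn A)
  obtain ⟨χ, hχ, hχQ, hm⟩ := exists_mem_QppValuedIrrChars_over hp hpow hθ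
  let infl : (G ⧸ A → ℂ) → G → ℂ := fun η g => η (QuotientGroup.mk' A g)
  have hinj : Function.Injective infl := fun a b hab => funext fun q => by
    obtain ⟨g, rfl⟩ := QuotientGroup.mk'_surjective A q
    exact congrFun hab g
  rw [← Set.ncard_image_of_injective _ hinj]
  refine Set.ncard_lt_ncard ⟨?_, fun hsub => ?_⟩ QppValuedIrrChars_finite
  · rintro _ ⟨η, ⟨hη, q, hq, hval⟩, rfl⟩
    exact ⟨hη.comp _ (QuotientGroup.mk'_surjective A), q, hq, fun g => hval _⟩
  · obtain ⟨η, -, rfl⟩ := hsub hχQ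
    refine hθ1 (eq_trivialOn_of_constant (fun g hg => ?_) hθ hm)
    have : QuotientGroup.mk' A g = QuotientGroup.mk' A 1 := by
      rw [map_one]
      exact (QuotientGroup.eq_one_iff g).2 hg
    exact congrArg η this

end Bound

theorem exists_card_le_of_ncard_le (k : ℕ) : ∃ B : ℕ, ∀ (G : Type) [Group G] [Fintype G],
    Group.IsSolvable G → (QppValuedIrrChars G).ncard ≤ k → Nat.card G ≤ B := by
  induction k with
  | zero =>
    refine ⟨1, fun G _ _ hG hk => ?_⟩
    by_contra! hcard
    have := Finite.one_lt_card_iff_nontrivial.1 hcard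
    obtain ⟨A, r, hA, hne, hr, hcomm, hpow⟩ := exists_normal_commute_of_isSolvable G
    have := ncard_quotient_lt hr hne hcomm hpow
    omega
  | succ k ih =>
    obtain ⟨B, hB⟩ := ih
    refine ⟨max 1 (B * (k + 1) * B), fun G _ _ hG hk => ?_⟩
    rcases le_or_gt (Nat.card G) 1 with hcard | hcard
    · exact hcard.trans (le_max_left _ _)
    have := Finite.one_lt_card_iff_nontrivial.1 hcard
    obtain ⟨A, r, hA, hne, hr, hcomm, hpow⟩ := exists_normal_commute_of_isSolvable G
    have hlt := ncard_quotient_lt hr hne hcomm hpow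
    have hle : A.index ≤ B := hB (G ⧸ A) inferInstance (by omega)
    refine le_trans ?_ (le_max_right _ _)
    rw [← A.card_mul_index]
    exact Nat.mul_le_mul ((card_le_ncard_mul_index hr hcomm hpow).trans (Nat.mul_le_mul hle hk)) hle

/-- For every positive integer `k` there are, up to isomorphism, only finitely many
finite solvable groups with exactly `k` `Q_pp`-valued irreducible characters:
there is a bound `B` on the order of any such group. -/
theorem finitely_many_solvable_groups_with_k_Qpp_irr_chars (k : ℕ) (hk : 0 < k) :
    ∃ B : ℕ, ∀ (G : Type) [Group G] [Fintype G],
      IsSolvable G → (QppValuedIrrChars G).ncard = k → Fintype.card G ≤ B := by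
  obtain ⟨B, hB⟩ := exists_card_le_of_ncard_le k
  exact ⟨B, fun G _ _ hG h => Nat.card_eq_fintype_card (α := G) ▸ hB G hG h.le⟩
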